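/- Fix j ≥ 1 and pairwise disjoint sets (J_α^s) for 1 ≤ s ≤ j, 1 ≤ α ≤ n_s, with |J_α^s| = s, all subsets of a common finite coordinate set. For a projection f = ⊕_{s=1}^{j} ⊕_{α=1}^{n_s} p_{J_α^s} ⊕ (t · e) over the product of spheres (t copies of the trivial rank-one projection e), and for n ∈ ℕ, the maximal c with c·e ≼ n·f equals Σ_{s=1}^{j} n_s · max{0, n − s} + n·t. -/

import Mathlib

open Matrix

/-- The 2-sphere, as the unit sphere in `ℝ³`. -/
def TwoSphere : Type := Metric.sphere (0 : EuclideanSpace ℝ (Fin 3)) 1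

noncomputable instance : TopologicalSpace TwoSphere :=
  inferInstanceAs (TopologicalSpace (Metric.sphere (0 : EuclideanSpace ℝ (Fin 3)) 1))

/-- The Bott projection `p ∈ C(S², M₂(ℂ))`, corresponding to the Hopf line bundle. -/
noncomputable def bott (v : TwoSphere) : Matrix (Fin 2) (Fin 2) ℂ :=
  (1 / 2 : ℂ) •
    !![1 + (v.1 2 : ℂ), (v.1 0 : ℂ) - (v.1 1 : ℂ) * Complex.I;
       (v.1 0 : ℂ) + (v.1 1 : ℂ) * Complex.I, 1 - (v.1 2 : ℂ)]

/-- A trivial rank-one `2×2` factor, the matrix unit `e₀₀`. -/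
noncomputable def trivFactor : Matrix (Fin 2) (Fin 2) ℂ :=
  Matrix.of fun a b => if a = 0 ∧ b = 0 then 1 else 0

/-- The projection `p_J = ⊗_{i∈J} (p ∘ π_i)` over `X = ∏_{i=1}^N S²`, realized in
`C(X, M_{2^N}(ℂ))` as a pointwise Kronecker product. -/
noncomputable def bottProj (N : ℕ) (J : Finset (Fin N)) (x : Fin N → TwoSphere) :
    Matrix (Fin N → Fin 2) (Fin N → Fin 2) ℂ :=
  Matrix.of fun a b => ∏ i, (if i ∈ J then bott (x i) else trivFactor) (a i) (b i)

/-- Murray–von Neumann subequivalence of (pointwise) projection-valued functions,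
witnessed by a continuous partial isometry `v` with `v*v = p` and `vv* ≤ q`. -/
def CSubequiv {X : Type*} [TopologicalSpace X] {ι κ : Type*} [Fintype ι] [Fintype κ]
    (p : X → Matrix ι ι ℂ) (q : X → Matrix κ κ ℂ) : Prop :=
  ∃ v : X → Matrix κ ι ℂ, Continuous v ∧
    ∀ x, (v x)ᴴ * v x = p x ∧ (v x * (v x)ᴴ) * q x = v x * (v x)ᴴ

/-- The projection `f = ⊕_{s=1}^{j} ⊕_{α=1}^{n_s} p_{J_α^s} ⊕ (t·e)` (here the index
`s : Fin j` represents `s+1 ∈ {1,...,j}`). -/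
noncomputable def fProj (N j t : ℕ) (ns : Fin j → ℕ)
    (J : (s : Fin j) → Fin (ns s) → Finset (Fin N)) (x : Fin N → TwoSphere) :
    Matrix ((Σ s : Fin j, (Fin N → Fin 2) × Fin (ns s)) ⊕ Fin t)
      ((Σ s : Fin j, (Fin N → Fin 2) × Fin (ns s)) ⊕ Fin t) ℂ :=
  Matrix.fromBlocks
    (Matrix.blockDiagonal' fun s : Fin j =>
      Matrix.blockDiagonal fun α : Fin (ns s) => bottProj N (J s α) x)
    0 0 (1 : Matrix (Fin t) (Fin t) ℂ)


/-! ### Combinatorics: the finite-difference identity -/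

theorem bd_alt_zero {ι : Type*} [Fintype ι] [DecidableEq ι] (k : ι) (g : Finset ι → ℤ)
    (hg : ∀ S, g (symmDiff S {k}) = g S) : ∑ S : Finset ι, (-1 : ℤ) ^ S.card * g S = 0 := by
  refine Finset.sum_involution (fun S _ => symmDiff S {k}) ?_ ?_ ?_ ?_
  · intro S _
    rw [hg]
    by_cases h : k ∈ S
    · have : symmDiff S {k} = S.erase k := by
        ext x; by_cases hx : x = k <;> simp [Finset.mem_symmDiff, hx, h]
      rw [this]
      have := Finset.card_erase_add_one h
      rw [← this, pow_succ]; ring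
    · have : symmDiff S {k} = insert k S := by
        ext x; by_cases hx : x = k <;> simp [Finset.mem_symmDiff, hx, h]
      rw [this, Finset.card_insert_of_notMem h, pow_succ]; ring
  · intro S _ _ h
    have := congrArg (fun T => symmDiff S T) h
    simp only [symmDiff_self] at this
    rw [symmDiff_symmDiff_cancel_left] at this
    simp at this
  · intro S _; simp
  · intro S _
    exact symmDiff_symmDiff_cancel_right _ _

theorem bd_alt_ne {ι : Type*} [Fintype ι] [DecidableEq ι] (q : ℕ) (a : ι → ι → ℕ)
    (ha : ∀ u, 1 ≤ a u u) :
    ∑ S : Finset ι, (-1 : ℤ) ^ S.card * ∏ i, ((q : ℤ) + ∑ k ∈ S, (a k i : ℤ)) ≠ 0 := by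
  classical
  let w : Finset ι → Option ι → ι → ℤ := fun S o i =>
    match o with
    | none => q
    | some k => if k ∈ S then (a k i : ℤ) else 0
  have h1 : ∀ S : Finset ι, ∏ i, ((q : ℤ) + ∑ k ∈ S, (a k i : ℤ)) =
      ∑ f : ι → Option ι, ∏ i, w S (f i) i := by
    intro S
    have : ∀ i, (q : ℤ) + ∑ k ∈ S, (a k i : ℤ) = ∑ o : Option ι, w S o i := by
      intro i
      rw [Fintype.sum_option]
      simp [w]
    simp only [this]
    rw [Finset.prod_univ_sum]
    simp
  simp only [h1, Finset.mul_sum]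
  rw [Finset.sum_comm]
  have h2 : ∀ f : ι → Option ι, (∑ S : Finset ι, (-1 : ℤ) ^ S.card * ∏ i, w S (f i) i) =
      if ∀ k, ∃ i, f i = some k then (-1) ^ (Fintype.card ι) * ∏ i, w Finset.univ (f i) i
      else 0 := by
    intro f
    split_ifs with h
    · rw [Finset.sum_eq_single Finset.univ]
      · simp
      · intro S _ hS
        obtain ⟨k, hk⟩ : ∃ k, k ∉ S := by
          by_contra hc; push Not at hc
          exact hS (Finset.eq_univ_iff_forall.2 hc)
        obtain ⟨i, hi⟩ := h k
        rw [Finset.prod_eq_zero (Finset.mem_univ i)]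
        · simp
        · simp [w, hi, hk]
      · simp
    · push Not at h
      obtain ⟨k, hk⟩ := h
      apply bd_alt_zero k
      intro S
      apply Finset.prod_congr rfl
      intro i _
      have := hk i
      cases hfi : f i with
      | none => rfl
      | some l =>
        have hl : l ≠ k := by rintro rfl; exact this hfi
        simp [w, Finset.mem_symmDiff, hl]
  simp only [h2]
  have h3 : ∀ f : ι → Option ι,
      (if ∀ k, ∃ i, f i = some k then (-1) ^ (Fintype.card ι) * ∏ i, w Finset.univ (f i) i
      else 0) = (-1) ^ (Fintype.card ι) *
      (if ∀ k, ∃ i, f i = some k then ∏ i, w Finset.univ (f i) i else 0) := by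
    intro f; split_ifs <;> simp
  simp only [h3]
  rw [← Finset.mul_sum]
  apply mul_ne_zero (by simp)
  apply ne_of_gt
  have hnn : ∀ f : ι → Option ι, 0 ≤ ∏ i, w Finset.univ (f i) i := by
    intro f
    apply Finset.prod_nonneg
    intro i _
    cases f i <;> simp [w]
  apply Finset.sum_pos'
  · intro f _
    split_ifs
    · exact hnn f
    · exact le_rfl
  · refine ⟨fun i => some i, Finset.mem_univ _, ?_⟩
    rw [if_pos (fun k => ⟨k, rfl⟩)]
    apply Finset.prod_pos
    intro i _
    simp only [w, Finset.mem_univ, if_true]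
    exact_mod_cast ha i

theorem bd_parity {I : Type*} [Fintype I] [DecidableEq I] (X : Matrix I I ℂ) (e : I → ℤ)
    (hX : ∀ i j, X i j ≠ 0 → e i = - e j) (hdet : X.det ≠ 0) : ∑ i, e i = 0 := by
  rw [Matrix.det_apply] at hdet
  obtain ⟨σ, _, hσ⟩ := Finset.exists_ne_zero_of_sum_ne_zero hdet
  have h1 : ∀ i, e (σ i) = - e i := by
    intro i
    apply hX
    intro h0
    apply hσ
    have : ∏ i, X (σ i) i = 0 := Finset.prod_eq_zero (Finset.mem_univ i) h0
    rw [this, smul_zero]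
  have h2 : ∑ i, e (σ i) = ∑ i, e i := Equiv.sum_comp σ e
  simp only [h1, Finset.sum_neg_distrib] at h2
  omega

/-! ### The Koszul (Clifford) matrix -/

/-- Koszul sign. -/
def kSgn {ι : Type*} (r : ι → ℕ) (k : ι) (S : Finset ι) : ℤ :=
  (-1) ^ (S.filter (fun l => r l < r k)).card

/-- Koszul matrix built out of `F` (wedge) and `G` (contraction). -/
def kosz {ι R : Type*} [Fintype ι] [DecidableEq ι] [CommRing R] (r : ι → ℕ) (F G : ι → R) :
    Matrix (Finset ι) (Finset ι) R :=
  Matrix.of fun S' S => ∑ k, if S' = symmDiff S {k} then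
    (kSgn r k S : R) * (if k ∈ S then G k else F k) else 0

theorem kSgn_sq {ι : Type*} (r : ι → ℕ) (k : ι) (S : Finset ι) : kSgn r k S * kSgn r k S = 1 := by
  unfold kSgn
  rw [← mul_pow]; simp

theorem kSgn_symmDiff {ι : Type*} [DecidableEq ι] (r : ι → ℕ) (k l : ι) (S : Finset ι) :
    kSgn r k (symmDiff S {l}) = (if r l < r k then -1 else 1) * kSgn r k S := by
  unfold kSgn
  by_cases h : l ∈ S
  · have : symmDiff S {l} = S.erase l := by
      ext x; by_cases hx : x = l <;> simp [Finset.mem_symmDiff, hx, h]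
    rw [this, Finset.filter_erase]
    split_ifs with hr
    · rw [← Finset.card_erase_add_one (s := S.filter (fun x => r x < r k)) (a := l) (by simp [h, hr]),
        pow_succ]
      ring
    · rw [Finset.erase_eq_of_notMem (by simp [hr])]; simp
  · have : symmDiff S {l} = insert l S := by
      ext x; by_cases hx : x = l <;> simp [Finset.mem_symmDiff, hx, h]
    rw [this, Finset.filter_insert]
    split_ifs with hr
    · rw [Finset.card_insert_of_notMem (by simp [h]), pow_succ]; ring
    · simp

theorem kosz_sq {ι R : Type*} [Fintype ι] [DecidableEq ι] [CommRing R] (r : ι → ℕ)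
    (hr : Function.Injective r) (F G : ι → R) :
    kosz r F G * kosz r F G = (∑ k, F k * G k) • (1 : Matrix (Finset ι) (Finset ι) R) := by
  ext S'' S
  rw [Matrix.mul_apply]
  set c : ι → Finset ι → R := fun k S => (kSgn r k S : R) * (if k ∈ S then G k else F k) with hc
  have h1 : ∑ S', kosz r F G S'' S' * kosz r F G S' S =
      ∑ k, ∑ l, if S'' = symmDiff (symmDiff S {k}) {l} then c l (symmDiff S {k}) * c k S else 0 := by
    have : ∀ S', kosz r F G S'' S' * kosz r F G S' S = ∑ k, if S' = symmDiff S {k} then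
        kosz r F G S'' S' * c k S else 0 := by
      intro S'
      conv_lhs => rw [show kosz r F G S' S = ∑ k, if S' = symmDiff S {k} then c k S else 0 from rfl]
      rw [Finset.mul_sum]
      apply Finset.sum_congr rfl
      intro k _
      split_ifs <;> simp
    simp only [this]
    rw [Finset.sum_comm]
    apply Finset.sum_congr rfl
    intro k _
    rw [Finset.sum_ite_eq' Finset.univ, if_pos (Finset.mem_univ _)]
    rw [show kosz r F G S'' (symmDiff S {k}) =
      ∑ l, if S'' = symmDiff (symmDiff S {k}) {l} then c l (symmDiff S {k}) else 0 from rfl]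
    rw [Finset.sum_mul]
    apply Finset.sum_congr rfl
    intro l _
    split_ifs <;> simp
  rw [h1]
  -- antisymmetry off the diagonal
  set t : ι → ι → R := fun k l =>
    if S'' = symmDiff (symmDiff S {k}) {l} then c l (symmDiff S {k}) * c k S else 0 with ht
  have hanti : ∀ k l, k ≠ l → t k l = - t l k := by
    intro k l hkl
    simp only [ht]
    rw [symmDiff_right_comm S {l} {k}]
    split_ifs
    · simp only [hc, kSgn_symmDiff, Finset.mem_symmDiff, Finset.mem_singleton, hkl, hkl.symm]
      have hne : r k ≠ r l := fun h => hkl (hr h)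
      rcases lt_or_gt_of_ne hne with h | h
      · by_cases hk : k ∈ S <;> by_cases hl : l ∈ S <;> simp [h, not_lt.2 h.le, hk, hl] <;> ring
      · by_cases hk : k ∈ S <;> by_cases hl : l ∈ S <;> simp [h, not_lt.2 h.le, hk, hl] <;> ring
    · simp
  have hdiag : ∀ k, t k k = if S'' = S then F k * G k else 0 := by
    intro k
    simp only [ht, symmDiff_symmDiff_cancel_right]
    split_ifs with h
    · simp only [hc, kSgn_symmDiff, Finset.mem_symmDiff, Finset.mem_singleton]
      have := congrArg (Int.cast : ℤ → R) (kSgn_sq r k S)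
      push_cast at this
      by_cases hk : k ∈ S
      · simp [hk]; linear_combination (F k * G k) * this
      · simp [hk]; linear_combination (F k * G k) * this
    · rfl
  have hsplit : ∑ k, ∑ l, t k l = ∑ k, t k k + ∑ k, ∑ l, if k ≠ l then t k l else 0 := by
    rw [← Finset.sum_add_distrib]
    apply Finset.sum_congr rfl
    intro k _
    rw [← Finset.add_sum_erase _ _ (Finset.mem_univ k)]
    congr 1
    rw [← Finset.add_sum_erase (a := k) _ _ (Finset.mem_univ k)]
    simp only [ne_eq, not_true_eq_false, if_false, zero_add]
    apply Finset.sum_congr rfl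
    intro l hl
    rw [if_pos (Finset.ne_of_mem_erase hl).symm]
  have hzero : ∑ k, ∑ l, (if k ≠ l then t k l else 0) = 0 := by
    rw [← Finset.sum_product']
    apply Finset.sum_involution (fun p _ => (p.2, p.1))
    · rintro ⟨k, l⟩ _
      by_cases h : k = l
      · simp [h]
      · simp only [ne_eq, h, not_false_eq_true, if_true, Ne.symm h]
        rw [hanti k l h]; simp
    · rintro ⟨k, l⟩ _ h1 h2
      simp only [Prod.mk.injEq] at h2
      apply h1
      simp [h2.1]
    · simp
    · simp
  rw [hsplit, hzero, add_zero]
  simp only [hdiag]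
  rw [Matrix.smul_apply, Matrix.one_apply]
  split_ifs <;> simp

/-! ### The symbol algebra -/

/-- Coefficient algebra: continuous functions on the cube. -/
abbrev Cf (ι : Type) := C(ι → unitInterval, ℂ)

/-- Symbols: trigonometric polynomials with coefficients continuous functions on the cube. -/
abbrev Sy (ι : Type) := AddMonoidAlgebra (Cf ι) (ι → ℤ)

/-- Monomial characters. -/
noncomputable def chr {ι : Type} [Fintype ι] (z : ι → Circle) : Multiplicative (ι → ℤ) →* ℂ where
  toFun k := ∏ i, ((z i : ℂ)) ^ (k.toAdd i)
  map_one' := by simp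
  map_mul' k l := by
    simp only [toAdd_mul, Pi.add_apply]
    rw [← Finset.prod_mul_distrib]
    exact Finset.prod_congr rfl fun i _ => zpow_add₀ (Circle.coe_ne_zero _) _ _

/-- Evaluation of a symbol. -/
noncomputable def ev {ι : Type} [Fintype ι] (s : ι → unitInterval) (z : ι → Circle) :
    Sy ι →+* ℂ :=
  AddMonoidAlgebra.liftNCRingHom ((Pi.evalRingHom _ s).comp ContinuousMap.coeFnRingHom) (chr z)
    (fun _ _ => Commute.all _ _)

theorem ev_single {ι : Type} [Fintype ι] (s : ι → unitInterval) (z : ι → Circle)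
    (k : ι → ℤ) (c : Cf ι) :
    ev s z (AddMonoidAlgebra.single k c) = c s * ∏ i, (z i : ℂ) ^ k i := by
  unfold ev
  rw [AddMonoidAlgebra.liftNCRingHom_single]
  rfl

theorem ev_apply {ι : Type} [Fintype ι] (s : ι → unitInterval) (z : ι → Circle) (P : Sy ι) :
    ev s z P = ∑ k ∈ P.coeff.support, P.coeff k s * ∏ i, (z i : ℂ) ^ k i := by
  conv_lhs => rw [← AddMonoidAlgebra.sum_coeff_single P]
  rw [Finsupp.sum, map_sum]
  simp only [ev_single]

theorem ev_continuous {ι : Type} [Fintype ι] (P : Sy ι) :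
    Continuous (fun p : (ι → unitInterval) × (ι → Circle) => ev p.1 p.2 P) := by
  simp only [ev_apply]
  refine continuous_finsetSum _ fun k _ => ?_
  refine Continuous.mul ((P.coeff k).continuous.comp continuous_fst) ?_
  refine continuous_finsetProd _ fun i _ => ?_
  refine Continuous.zpow₀ ?_ _ ?_
  · exact continuous_subtype_val.comp ((continuous_apply i).comp continuous_snd)
  · intro p; exact Or.inl (Circle.coe_ne_zero _)

theorem bd_root_sum (N : ℕ) (hN : 0 < N) (n : ℤ) (hn : |n| < N) :
    ∑ j : Fin N, (((Circle.exp (2 * Real.pi / N)) ^ (j : ℕ) : Circle) : ℂ) ^ n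
      = if n = 0 then (N : ℂ) else 0 := by
  split_ifs with h
  · subst h; simp
  have hprim : IsPrimitiveRoot ((Circle.exp (2 * Real.pi / N) : Circle) : ℂ) N := by
    have := Complex.isPrimitiveRoot_exp N hN.ne'
    rw [Circle.coe_exp]
    convert this using 2
    push_cast; ring
  set ζ : ℂ := ((Circle.exp (2 * Real.pi / N) : Circle) : ℂ) with hζ
  have h1 : ζ ^ n ≠ 1 := by
    intro h1
    rw [hprim.zpow_eq_one_iff_dvd] at h1
    have := Int.eq_zero_of_abs_lt_dvd h1 hn
    exact h this
  have h2 : ∀ j : Fin N, (((Circle.exp (2 * Real.pi / N)) ^ (j : ℕ) : Circle) : ℂ) ^ n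
      = (ζ ^ n) ^ (j : ℕ) := by
    intro j
    rw [Circle.coe_pow, ← hζ, ← zpow_natCast, ← zpow_natCast, ← _root_.zpow_mul, ← _root_.zpow_mul, mul_comm]
  simp only [h2]
  rw [Fin.sum_univ_eq_sum_range (fun j => (ζ ^ n) ^ j) N]
  have h3 := geom_sum_mul (ζ ^ n) N
  have h4 : (ζ ^ n) ^ N = 1 := by
    rw [← zpow_natCast, ← _root_.zpow_mul, mul_comm, _root_.zpow_mul, zpow_natCast, hprim.pow_eq_one, _root_.one_zpow]
  rw [h4, sub_self] at h3
  rcases mul_eq_zero.1 h3 with h5 | h5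
  · exact h5
  · exact absurd (sub_eq_zero.1 h5) h1

theorem bd_exists_box {ι : Type} [Fintype ι] (T : Finset (ι → ℤ)) :
    ∃ B : ℕ, ∀ l ∈ T, ∀ i, |l i| ≤ B := by
  refine ⟨∑ l ∈ T, ∑ i, (l i).natAbs, ?_⟩
  intro l hl i
  have h1 : (l i).natAbs ≤ ∑ i, (l i).natAbs :=
    Finset.single_le_sum (f := fun i => (l i).natAbs) (fun _ _ => Nat.zero_le _)
      (Finset.mem_univ i)
  have h2 : ∑ i, (l i).natAbs ≤ ∑ l ∈ T, ∑ i, (l i).natAbs :=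
    Finset.single_le_sum (f := fun l : ι → ℤ => ∑ i, (l i).natAbs) (fun _ _ => Nat.zero_le _) hl
  rw [Int.abs_eq_natAbs]
  exact_mod_cast h1.trans h2

theorem trig_bound {ι : Type} [Fintype ι] (T : Finset (ι → ℤ)) (c : (ι → ℤ) → ℂ)
    (ρ : ℝ) (h : ∀ z : ι → Circle, ‖∑ k ∈ T, c k * ∏ i, (z i : ℂ) ^ k i‖ ≤ ρ) (k : ι → ℤ)
    (hk : k ∈ T) : ‖c k‖ ≤ ρ := by
  classical
  obtain ⟨N, hN0, hN⟩ : ∃ N : ℕ, 0 < N ∧ ∀ l ∈ T, ∀ i, |l i - k i| < N := by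
    obtain ⟨B, hB⟩ := bd_exists_box T
    refine ⟨2 * B + 1, Nat.succ_pos _, fun l hl i => ?_⟩
    have h1 := hB l hl i
    have h2 := hB k hk i
    have h3 := abs_sub (l i) (k i)
    push_cast
    linarith
  obtain ⟨ζ, hζ⟩ : ∃ ζ : Circle, ∀ n : ℤ, |n| < N →
      ∑ j : Fin N, ((ζ ^ (j : ℕ) : Circle) : ℂ) ^ n = if n = 0 then (N : ℂ) else 0 :=
    ⟨Circle.exp (2 * Real.pi / N), fun n hn => bd_root_sum N hN0 n hn⟩
  obtain ⟨zz, hzz⟩ : ∃ zz : (ι → Fin N) → ι → Circle, ∀ j i, zz j i = ζ ^ (j i : ℕ) :=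
    ⟨fun j i => ζ ^ (j i : ℕ), fun _ _ => rfl⟩
  have key : ∑ j : ι → Fin N, (∑ k ∈ T, c k * ∏ i, (zz j i : ℂ) ^ k i) * ∏ i, (zz j i : ℂ) ^ (-(k i))
      = (N : ℂ) ^ (Fintype.card ι) * c k := by
    have h1 : ∀ j : ι → Fin N, (∑ k ∈ T, c k * ∏ i, (zz j i : ℂ) ^ k i) * ∏ i, (zz j i : ℂ) ^ (-(k i)) =
        ∑ l ∈ T, c l * ∏ i, (zz j i : ℂ) ^ (l i - k i) := by
      intro j
      rw [Finset.sum_mul]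
      refine Finset.sum_congr rfl fun l _ => ?_
      rw [mul_assoc, ← Finset.prod_mul_distrib]
      congr 1
      refine Finset.prod_congr rfl fun i _ => ?_
      rw [← zpow_add₀ (Circle.coe_ne_zero _), sub_eq_add_neg]
    simp only [h1]
    rw [Finset.sum_comm]
    have h2 : ∀ l ∈ T,
        ∑ j : ι → Fin N, c l * ∏ i, (zz j i : ℂ) ^ (l i - k i) =
        if l = k then (N : ℂ) ^ (Fintype.card ι) * c k else 0 := by
      intro l hl
      rw [← Finset.mul_sum]
      have h3 := Finset.prod_univ_sum (fun _ : ι => (Finset.univ : Finset (Fin N)))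
        (fun i (j : Fin N) => ((ζ ^ (j : ℕ) : Circle) : ℂ) ^ (l i - k i))
      rw [Fintype.piFinset_univ] at h3
      simp only [hzz]
      rw [← h3]
      have h4 : ∀ i, ∑ j : Fin N, ((ζ ^ (j : ℕ) : Circle) : ℂ) ^ (l i - k i) =
          if l i - k i = 0 then (N : ℂ) else 0 := fun i => hζ _ (hN l hl i)
      simp only [h4]
      split_ifs with h5
      · subst h5
        simp [mul_comm]
      · obtain ⟨i, hi⟩ : ∃ i, l i ≠ k i := by
          by_contra hc; push Not at hc; exact h5 (funext hc)
        rw [Finset.prod_eq_zero (Finset.mem_univ i), mul_zero]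
        rw [if_neg (sub_ne_zero.2 hi)]
    rw [Finset.sum_congr rfl h2, Finset.sum_ite_eq' , if_pos hk]
  have hb : ‖(N : ℂ) ^ (Fintype.card ι) * c k‖ ≤ (N : ℝ) ^ (Fintype.card ι) * ρ := by
    rw [← key]
    refine (norm_sum_le _ _).trans ?_
    have : ∀ j ∈ (Finset.univ : Finset (ι → Fin N)),
        ‖(∑ k ∈ T, c k * ∏ i, (zz j i : ℂ) ^ k i) * ∏ i, (zz j i : ℂ) ^ (-(k i))‖ ≤ ρ := by
      intro j _
      rw [norm_mul, norm_prod]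
      simp only [norm_zpow, Circle.norm_coe, _root_.one_zpow, Finset.prod_const_one, mul_one]
      exact h _
    refine (Finset.sum_le_sum this).trans ?_
    simp
  rw [norm_mul, norm_pow, Complex.norm_natCast] at hb
  exact le_of_mul_le_mul_left hb (by positivity)

theorem coeff_bound {ι : Type} [Fintype ι] (P : Sy ι) (s : ι → unitInterval)
    (ρ : ℝ) (h : ∀ z, ‖ev s z P‖ ≤ ρ) (k : ι → ℤ) : ‖P.coeff k s‖ ≤ ρ := by
  have hρ : 0 ≤ ρ := le_trans (norm_nonneg _) (h (fun _ => 1))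
  by_cases hk : k ∈ P.coeff.support
  · refine trig_bound P.coeff.support (fun k => P.coeff k s) ρ (fun z => ?_) k hk
    rw [← ev_apply]
    exact h z
  · rw [Finsupp.notMem_support_iff] at hk
    rw [hk, ContinuousMap.zero_apply, norm_zero]
    exact hρ

theorem supp_pow {ι : Type} [Fintype ι] [DecidableEq ι] (h : Sy ι) (B : ℕ)
    (hB : ∀ k, h.coeff k ≠ 0 → ∀ i, |k i| ≤ B) (m : ℕ) :
    ∀ k, (h ^ m).coeff k ≠ 0 → ∀ i, |k i| ≤ (m * B : ℕ) := by
  induction m with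
  | zero =>
    intro k hk i
    rw [pow_zero, AddMonoidAlgebra.one_def, AddMonoidAlgebra.coeff_single] at hk
    have : k = 0 := by
      by_contra hc
      exact hk (Finsupp.single_eq_of_ne hc)
    simp [this]
  | succ m ih =>
    intro k hk i
    rw [pow_succ] at hk
    have h1 := AddMonoidAlgebra.support_coeff_mul_subset (x := h ^ m) (y := h)
      (Finsupp.mem_support_iff.2 hk)
    obtain ⟨a, ha, b, hb, rfl⟩ := Finset.mem_add.1 h1
    have h2 := ih a (Finsupp.mem_support_iff.1 ha) i
    have h3 := hB b (Finsupp.mem_support_iff.1 hb) i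
    have h4 := abs_add_le (a i) (b i)
    push_cast at *
    simp only [Pi.add_apply]
    linarith

theorem small_pow {ι : Type} [Fintype ι] (h : Sy ι) (ρ : ℝ) (hρ : ρ < 1)
    (hh : ∀ s z, ‖ev s z h‖ ≤ ρ) (ε : ℝ) (hε : 0 < ε) :
    ∃ m : ℕ, ∑ k ∈ (h ^ m).coeff.support, ‖(h ^ m).coeff k‖ < ε := by
  classical
  have hρ0 : 0 ≤ ρ := le_trans (norm_nonneg _) (hh (fun _ => 0) (fun _ => 1))
  obtain ⟨B, hB'⟩ := bd_exists_box h.coeff.support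
  have hB : ∀ l, h.coeff l ≠ 0 → ∀ i, |l i| ≤ B := fun l hl =>
    hB' l (Finsupp.mem_support_iff.2 hl)
  set K := Fintype.card ι
  have hbound : ∀ m : ℕ, 1 ≤ m → ∑ k ∈ (h ^ m).coeff.support, ‖(h ^ m).coeff k‖ ≤
      ((2 * B + 1 : ℕ) : ℝ) ^ K * ((m : ℝ) ^ K * ρ ^ m) := by
    intro m hm
    have h1 : ∀ k ∈ (h ^ m).coeff.support, ‖(h ^ m).coeff k‖ ≤ ρ ^ m := by
      intro k _
      rw [ContinuousMap.norm_le _ (by positivity)]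
      intro s
      apply coeff_bound
      intro z
      rw [map_pow, norm_pow]
      exact pow_le_pow_left₀ (norm_nonneg _) (hh s z) m
    refine (Finset.sum_le_sum h1).trans ?_
    rw [Finset.sum_const, nsmul_eq_mul, ← mul_assoc]
    refine mul_le_mul_of_nonneg_right ?_ (by positivity)
    have h2 : (h ^ m).coeff.support ⊆
        Finset.Icc (fun _ : ι => -((m * B : ℕ) : ℤ)) (fun _ => ((m * B : ℕ) : ℤ)) := by
      intro k hk
      have := supp_pow h B hB m k (Finsupp.mem_support_iff.1 hk)
      rw [Finset.mem_Icc]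
      exact ⟨fun i => (abs_le.1 (this i)).1, fun i => (abs_le.1 (this i)).2⟩
    have h3 := Finset.card_le_card h2
    rw [Pi.card_Icc] at h3
    simp only [Int.card_Icc, Finset.prod_const, Finset.card_univ] at h3
    have h4 : (((m * B : ℕ) : ℤ) + 1 - -((m * B : ℕ) : ℤ)).toNat ≤ (2 * B + 1) * m := by
      have : (2 * B + 1) * m = 2 * (m * B) + m := by ring
      omega
    have h5 : (h ^ m).coeff.support.card ≤ ((2 * B + 1) * m) ^ K :=
      h3.trans (Nat.pow_le_pow_left h4 _)
    rw [← mul_pow]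
    exact_mod_cast h5
  have hlim := (tendsto_pow_const_mul_const_pow_of_abs_lt_one K
    (abs_lt.2 ⟨by linarith, hρ⟩)).const_mul (((2 * B + 1 : ℕ) : ℝ) ^ K)
  rw [mul_zero] at hlim
  obtain ⟨m, hm1, hm2⟩ := ((hlim.eventually (gt_mem_nhds hε)).and
    (Filter.eventually_ge_atTop 1)).exists
  exact ⟨m, (hbound m hm2).trans_lt hm1⟩

/-- Boundary behaviour of symbols of weight `a`. -/
def Filt {ι : Type} (a : ι → ℤ) (P : Sy ι) : Prop :=
  ∀ (k : ι → ℤ) (i : ι) (s : ι → unitInterval),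
    (s i = 0 → k i ≠ 0 → P.coeff k s = 0) ∧ (s i = 1 → k i ≠ a i → P.coeff k s = 0)

theorem Filt.zero {ι : Type} (a : ι → ℤ) : Filt a (0 : Sy ι) := by
  intro k i s; simp

theorem Filt.add {ι : Type} {a : ι → ℤ} {P Q : Sy ι} (hP : Filt a P) (hQ : Filt a Q) :
    Filt a (P + Q) := by
  intro k i s
  simp only [AddMonoidAlgebra.coeff_add, Finsupp.add_apply, ContinuousMap.add_apply]
  exact ⟨fun h1 h2 => by rw [(hP k i s).1 h1 h2, (hQ k i s).1 h1 h2, add_zero],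
    fun h1 h2 => by rw [(hP k i s).2 h1 h2, (hQ k i s).2 h1 h2, add_zero]⟩

theorem Filt.neg {ι : Type} {a : ι → ℤ} {P : Sy ι} (hP : Filt a P) : Filt a (-P) := by
  intro k i s
  rw [AddMonoidAlgebra.coeff_neg, Finsupp.neg_apply, ContinuousMap.neg_apply]
  exact ⟨fun h1 h2 => by rw [(hP k i s).1 h1 h2, neg_zero],
    fun h1 h2 => by rw [(hP k i s).2 h1 h2, neg_zero]⟩

theorem Filt.sum {ι β : Type} {a : ι → ℤ} (T : Finset β) (f : β → Sy ι)
    (h : ∀ b ∈ T, Filt a (f b)) : Filt a (∑ b ∈ T, f b) := by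
  classical
  induction T using Finset.induction_on with
  | empty => simpa using Filt.zero a
  | insert x T hx ih =>
    rw [Finset.sum_insert hx]
    exact (h x (Finset.mem_insert_self _ _)).add (ih fun b hb => h b (Finset.mem_insert_of_mem hb))

theorem Filt.mul {ι : Type} {a b c : ι → ℤ} {P Q : Sy ι} (hP : Filt a P) (hQ : Filt b Q)
    (hc : ∀ i, c i = a i + b i) : Filt c (P * Q) := by
  classical
  intro k i s
  rw [AddMonoidAlgebra.coeff_mul]
  simp only [Finsupp.sum, ContinuousMap.coe_sum, Finset.sum_apply]
  constructor
  · intro h1 h2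
    refine Finset.sum_eq_zero fun l _ => Finset.sum_eq_zero fun m _ => ?_
    split_ifs with h3
    · rw [ContinuousMap.mul_apply]
      by_cases h4 : l i = 0
      · have h5 : m i ≠ 0 := by
          intro h5; apply h2; rw [← h3, Pi.add_apply, h4, h5, add_zero]
        rw [(hQ m i s).1 h1 h5, mul_zero]
      · rw [(hP l i s).1 h1 h4, zero_mul]
    · rfl
  · intro h1 h2
    refine Finset.sum_eq_zero fun l _ => Finset.sum_eq_zero fun m _ => ?_
    split_ifs with h3
    · rw [ContinuousMap.mul_apply]
      by_cases h4 : l i = a i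
      · have h5 : m i ≠ b i := by
          intro h5; apply h2; rw [← h3, Pi.add_apply, h4, h5, hc]
        rw [(hQ m i s).2 h1 h5, mul_zero]
      · rw [(hP l i s).2 h1 h4, zero_mul]
    · rfl

theorem Filt.const {ι : Type} (c : Cf ι) : Filt (0 : ι → ℤ) (AddMonoidAlgebra.single 0 c) := by
  classical
  intro k i s
  rw [AddMonoidAlgebra.coeff_single_apply]
  constructor
  · intro _ h2
    rw [if_neg (fun h => h2 (by rw [← h]; rfl))]; rfl
  · intro _ h2
    rw [if_neg (fun h => h2 (by rw [← h]))]; rfl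

theorem Filt.one {ι : Type} : Filt (0 : ι → ℤ) (1 : Sy ι) := Filt.const 1

theorem Filt.pow {ι : Type} {P : Sy ι} (hP : Filt 0 P) (m : ℕ) : Filt 0 (P ^ m) := by
  induction m with
  | zero => rw [pow_zero]; exact Filt.one
  | succ m ih => rw [pow_succ]; exact ih.mul hP (by simp)

theorem Filt.intCast {ι : Type} (n : ℤ) : Filt (0 : ι → ℤ) (n : Sy ι) := Filt.const _

theorem Filt.congr {ι : Type} {a b : ι → ℤ} {P : Sy ι} (hP : Filt a P) (h : ∀ i, a i = b i) :
    Filt b P := by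
  rwa [← funext h]

/-! ### Quantization -/

/-- Sample point. -/
noncomputable def pt {ι : Type} (q : ℕ) (m : ι → ℤ) : ι → unitInterval :=
  fun i => Set.projIcc (0 : ℝ) 1 zero_le_one ((m i : ℝ) / q)

theorem pt_dist {ι : Type} (q : ℕ) (m l : ι → ℤ) (i : ι) :
    dist (pt q (m + l) i) (pt q m i) ≤ |(l i : ℝ)| / q := by
  rw [Subtype.dist_eq, Real.dist_eq]
  refine (Set.abs_projIcc_sub_projIcc zero_le_one).trans ?_
  rw [← sub_div, abs_div]
  simp

theorem quant_small {ι : Type} [Fintype ι] (f g : Cf ι) (l : ι → ℤ) (d d' : ι → ℕ)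
    (hg : ∀ (i : ι) (s : ι → unitInterval), (s i = 0 → l i ≠ 0 → g s = 0) ∧
      (s i = 1 → l i ≠ (d' i : ℤ) - d i → g s = 0)) (η : ℝ) (hη : 0 < η) :
    ∀ᶠ q : ℕ in Filter.atTop, ∀ m : ι → ℤ, (∀ i, 0 ≤ m i ∧ m i < (q + d i : ℕ)) →
      (∀ c : ℂ, ((∀ i, 0 ≤ m i + l i ∧ m i + l i < (q + d' i : ℕ)) ∧ c = f (pt q (m + l)) ∨
        (¬ ∀ i, 0 ≤ m i + l i ∧ m i + l i < (q + d' i : ℕ)) ∧ c = 0) →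
      ‖(c - f (pt q m)) * g (pt q m)‖ ≤ η) := by
  classical
  set C : ℝ := ‖f‖ + ‖g‖ + 1 with hC
  have hCpos : 0 < C := by positivity
  have hfu := CompactSpace.uniformContinuous_of_continuous f.continuous
  have hgu := CompactSpace.uniformContinuous_of_continuous g.continuous
  obtain ⟨δ1, hδ1, hf⟩ := Metric.uniformContinuous_iff.1 hfu (η / C) (by positivity)
  obtain ⟨δ2, hδ2, hg2⟩ := Metric.uniformContinuous_iff.1 hgu (η / C) (by positivity)
  obtain ⟨B, hB⟩ := bd_exists_box {l}
  have hB' : ∀ i, |(l i : ℝ)| ≤ B := by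
    intro i; exact_mod_cast hB l (Finset.mem_singleton_self _) i
  have hlim : Filter.Tendsto (fun q : ℕ => (B : ℝ) / q) Filter.atTop (nhds 0) :=
    tendsto_const_div_atTop_nhds_zero_nat (B : ℝ)
  filter_upwards [hlim.eventually (gt_mem_nhds hδ1), hlim.eventually (gt_mem_nhds hδ2),
    Filter.eventually_gt_atTop 0] with q hq1 hq2 hq0 m hm c hc
  have hq0' : (0 : ℝ) < q := by exact_mod_cast hq0
  rw [norm_mul]
  rcases hc with ⟨_, rfl⟩ | ⟨hout, rfl⟩
  · have h1 : ‖f (pt q (m + l)) - f (pt q m)‖ ≤ η / C := by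
      rw [← dist_eq_norm]
      refine (hf ?_).le
      refine lt_of_le_of_lt ?_ hq1
      rw [dist_pi_le_iff (by positivity)]
      intro i
      exact (pt_dist q m l i).trans (by gcongr; exact hB' i)
    calc _ ≤ (η / C) * C := by
          gcongr
          have := g.norm_coe_le_norm (pt q m)
          have := norm_nonneg f
          linarith
      _ = η := by field_simp
  · -- out of range
    push Not at hout
    obtain ⟨i, hi⟩ := hout
    have key : ∀ b : unitInterval, (∀ s : ι → unitInterval, s i = b → g s = 0) →
        dist (pt q m i) b ≤ (B : ℝ) / q → ‖g (pt q m)‖ ≤ η / C := by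
      intro b hb hd
      have h0 := hb (Function.update (pt q m) i b) (by simp)
      rw [← sub_zero (g (pt q m)), ← h0, ← dist_eq_norm]
      refine (hg2 ?_).le
      refine lt_of_le_of_lt ?_ hq2
      rw [dist_pi_le_iff (by positivity)]
      intro i'
      by_cases h : i' = i
      · subst h; simpa using hd
      · simp [h]; positivity
    have hgs : ‖g (pt q m)‖ ≤ η / C := by
      have hm1 := (hm i).1
      have hm2 := (hm i).2
      have hli := hB l (Finset.mem_singleton_self _) i
      by_cases hneg : m i + l i < 0
      · apply key 0 (fun s hs => (hg i s).1 hs (by omega))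
        rw [Subtype.dist_eq, Real.dist_eq]
        have h1 : |((pt q m i : unitInterval) : ℝ) - ((0 : unitInterval) : ℝ)| ≤ |(m i : ℝ) / q - 0| := by
          have := Set.abs_projIcc_sub_projIcc (a := (0 : ℝ)) (b := 1) (c := (m i : ℝ) / q) (d := 0)
            zero_le_one
          simpa [pt, Set.projIcc_left] using this
        refine h1.trans ?_
        rw [sub_zero, abs_div, Nat.abs_cast]
        gcongr
        have h2 : |m i| ≤ (B : ℤ) := by
          rw [abs_of_nonneg hm1]
          have := neg_abs_le (l i)
          omega
        exact_mod_cast h2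
      · have h3 := hi (by omega)
        push_cast at h3 hm2
        apply key 1 (fun s hs => (hg i s).2 hs (by omega))
        rw [Subtype.dist_eq, Real.dist_eq]
        have hq' : (q : ℤ) - B ≤ m i := by
          have := le_abs_self (l i)
          omega
        have hqr : (q : ℝ) - B ≤ m i := by exact_mod_cast hq'
        have hx0 : (0 : ℝ) ≤ (m i : ℝ) / q := by
          apply div_nonneg _ hq0'.le
          exact_mod_cast hm1
        have hx1 : 1 - (B : ℝ) / q ≤ (m i : ℝ) / q := by
          rw [sub_le_iff_le_add, ← add_div, le_div_iff₀ hq0']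
          linarith
        have hBq : 0 ≤ (B : ℝ) / q := by positivity
        have hv : ((pt q m i : unitInterval) : ℝ) = max 0 (min 1 ((m i : ℝ) / q)) := by
          simp [pt, Set.coe_projIcc]
        rw [hv, abs_le]
        constructor
        · have : 1 - (B : ℝ) / q ≤ min 1 ((m i : ℝ) / q) := le_min (by linarith) hx1
          have h5 := le_max_right 0 (min 1 ((m i : ℝ) / q))
          simp only [Set.Icc.coe_one] at *
          linarith
        · have : max 0 (min 1 ((m i : ℝ) / q)) ≤ 1 := max_le zero_le_one (min_le_left _ _)
          simp only [Set.Icc.coe_one] at *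
          linarith
    calc _ ≤ C * (η / C) := by
          gcongr
          rw [zero_sub, norm_neg]
          have := f.norm_coe_le_norm (pt q m)
          have := norm_nonneg g
          linarith
      _ = η := by field_simp

theorem sum_inj_le {α β : Type} [Fintype α] (e : α → β) (he : Function.Injective e)
    (T : Finset β) (f : β → ℝ) (h0 : ∀ b, 0 ≤ f b) (hT : ∀ b, b ∉ T → f b = 0) :
    ∑ a, f (e a) ≤ ∑ b ∈ T, f b := by
  classical
  rw [← Finset.sum_image (f := f) (s := Finset.univ) (g := e) (fun _ _ _ _ h => he h)]
  rw [← Finset.sum_inter_add_sum_sdiff (Finset.univ.image e) T]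
  rw [Finset.sum_eq_zero (s := Finset.univ.image e \ T)
    (fun b hb => hT b (Finset.mem_sdiff.1 hb).2), add_zero]
  exact Finset.sum_le_sum_of_subset_of_nonneg Finset.inter_subset_right fun _ _ _ => h0 _

theorem sum_inj_eq {α β : Type} [Fintype α] (e : α → β) (he : Function.Injective e)
    (T : Finset β) (f : β → ℂ) (hT : ∀ b, b ∉ T → f b = 0) (R : β → Prop) [DecidablePred R]
    (hR : ∀ b, R b ↔ ∃ a, e a = b) :
    ∑ a, f (e a) = ∑ b ∈ T, if R b then f b else 0 := by
  classical
  rw [← Finset.sum_image (f := f) (s := Finset.univ) (g := e) (fun _ _ _ _ h => he h)]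
  rw [← Finset.sum_inter_add_sum_sdiff (Finset.univ.image e) T]
  rw [Finset.sum_eq_zero (s := Finset.univ.image e \ T)
    (fun b hb => hT b (Finset.mem_sdiff.1 hb).2), add_zero]
  rw [← Finset.sum_filter]
  refine Finset.sum_congr ?_ fun _ _ => rfl
  ext b
  simp [hR, and_comm]

theorem coeff_mul_box {ι : Type} (P Q : Sy ι) (T : Finset (ι → ℤ))
    (hT : ∀ l, l ∉ T → Q.coeff l = 0) (k : ι → ℤ) :
    (P * Q).coeff k = ∑ l ∈ T, P.coeff (k - l) * Q.coeff l := by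
  classical
  rw [AddMonoidAlgebra.coeff_mul]
  simp only [Finsupp.sum]
  rw [Finset.sum_comm]
  have h1 : ∀ l ∈ Q.coeff.support, (∑ y ∈ P.coeff.support,
      if y + l = k then P.coeff y * Q.coeff l else 0) = P.coeff (k - l) * Q.coeff l := by
    intro l _
    have : ∀ y : ι → ℤ, (y + l = k) ↔ (k - l = y) := fun y =>
      ⟨fun h => by rw [← h, add_sub_cancel_right], fun h => by rw [← h, sub_add_cancel]⟩
    simp only [this]
    rw [Finset.sum_ite_eq]
    split_ifs with h
    · rfl
    · rw [Finsupp.notMem_support_iff.1 h, zero_mul]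
  rw [Finset.sum_congr rfl h1]
  refine Finset.sum_subset ?_ ?_
  · intro l hl
    by_contra h
    exact Finsupp.mem_support_iff.1 hl (hT l h)
  · intro l _ hl
    rw [Finsupp.notMem_support_iff.1 hl, mul_zero]

theorem gersh {I : Type} [Fintype I] [DecidableEq I] (A : Matrix I I ℂ)
    (h : ∀ y, ∑ x, ‖(A - 1) x y‖ < 1) : A.det ≠ 0 := by
  apply det_ne_zero_of_sum_col_lt_diag
  intro y
  have h1 := h y
  rw [← Finset.add_sum_erase _ _ (Finset.mem_univ y)] at h1
  have h2 : ∑ x ∈ Finset.univ.erase y, ‖(A - 1) x y‖ = ∑ x ∈ Finset.univ.erase y, ‖A x y‖ := by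
    refine Finset.sum_congr rfl fun x hx => ?_
    rw [Matrix.sub_apply, Matrix.one_apply_ne (Finset.ne_of_mem_erase hx), sub_zero]
  rw [h2, Matrix.sub_apply, Matrix.one_apply_eq] at h1
  have h3 : 1 ≤ ‖A y y‖ + ‖A y y - 1‖ := by
    have := norm_sub_le (A y y) (A y y - 1)
    simpa using this
  linarith

/-- Quantization matrix. -/
noncomputable def QM {ι Λ : Type} (d : Λ → ι → ℕ) (q : ℕ) (D : Matrix Λ Λ (Sy ι)) :
    Matrix (Σ S : Λ, (∀ i, Fin (q + d S i))) (Σ S : Λ, (∀ i, Fin (q + d S i))) ℂ :=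
  Matrix.of fun x y => (D x.1 y.1).coeff (fun i => ((x.2 i : ℕ) : ℤ) - ((y.2 i : ℕ) : ℤ))
    (pt q (fun i => ((y.2 i : ℕ) : ℤ)))

theorem quant {ι Λ : Type} [Fintype ι] [DecidableEq ι] [Fintype Λ] [DecidableEq Λ]
    (d : Λ → ι → ℕ) (D E : Matrix Λ Λ (Sy ι)) (H : Sy ι)
    (hE : ∀ S' S, Filt (fun i => (d S' i : ℤ) - d S i) (E S' S))
    (hDE : D * E = (1 - H) • (1 : Matrix Λ Λ (Sy ι)))
    (hH : ∑ k ∈ H.coeff.support, ‖H.coeff k‖ < 1 / 2) :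
    ∃ q, (QM d q D).det ≠ 0 := by
  classical
  obtain ⟨T, hTD, hTE⟩ : ∃ T : Finset (ι → ℤ), (∀ S' S l, l ∉ T → (D S' S).coeff l = 0) ∧
      (∀ S' S l, l ∉ T → (E S' S).coeff l = 0) := by
    refine ⟨Finset.univ.biUnion fun p : Λ × Λ =>
      (D p.1 p.2).coeff.support ∪ (E p.1 p.2).coeff.support, ?_, ?_⟩
    · intro S' S l hl
      by_contra h
      exact hl (Finset.mem_biUnion.2 ⟨(S', S), Finset.mem_univ _,
        Finset.mem_union_left _ (Finsupp.mem_support_iff.2 h)⟩)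
    · intro S' S l hl
      by_contra h
      exact hl (Finset.mem_biUnion.2 ⟨(S', S), Finset.mem_univ _,
        Finset.mem_union_right _ (Finsupp.mem_support_iff.2 h)⟩)
  set M : ℝ := (Fintype.card Λ : ℝ) * ((Fintype.card Λ : ℝ) * ((T.card : ℝ) * (T.card : ℝ))) with hM
  have hM0 : 0 ≤ M := by positivity
  obtain ⟨η, hη, hMη⟩ : ∃ η : ℝ, 0 < η ∧ M * η < 1 / 2 := by
    refine ⟨1 / (2 * (M + 1)), by positivity, ?_⟩
    rw [mul_one_div, div_lt_div_iff₀ (by positivity) (by positivity)]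
    linarith
  have hev : ∀ᶠ q : ℕ in Filter.atTop, ∀ p : Λ × Λ × Λ × T × T,
      ∀ m : ι → ℤ, (∀ i, 0 ≤ m i ∧ m i < (q + d p.2.2.1 i : ℕ)) →
      (∀ c : ℂ, ((∀ i, 0 ≤ m i + p.2.2.2.2.1 i ∧ m i + p.2.2.2.2.1 i < (q + d p.2.1 i : ℕ)) ∧
        c = (D p.1 p.2.1).coeff p.2.2.2.1.1 (pt q (m + p.2.2.2.2.1)) ∨
        (¬ ∀ i, 0 ≤ m i + p.2.2.2.2.1 i ∧ m i + p.2.2.2.2.1 i < (q + d p.2.1 i : ℕ)) ∧ c = 0) →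
      ‖(c - (D p.1 p.2.1).coeff p.2.2.2.1.1 (pt q m)) *
        (E p.2.1 p.2.2.1).coeff p.2.2.2.2.1 (pt q m)‖ ≤ η) := by
    rw [Filter.eventually_all]
    intro p
    exact quant_small _ _ _ _ _ (fun i s => hE _ _ _ i s) η hη
  obtain ⟨q, hq⟩ := hev.exists
  refine ⟨q, fun hdet => ?_⟩
  have : (QM d q D * QM d q E).det ≠ 0 := by
    apply gersh
    rintro ⟨S, y⟩
    set m : ι → ℤ := fun i => ((y i : ℕ) : ℤ) with hm
    have hmr : ∀ i, 0 ≤ m i ∧ m i < (q + d S i : ℕ) := fun i =>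
      ⟨Int.natCast_nonneg _, Nat.cast_lt.2 (y i).2⟩
    let R : Λ → (ι → ℤ) → Prop := fun S' l => ∀ i, 0 ≤ m i + l i ∧ m i + l i < (q + d S' i : ℕ)
    let err : Λ → Λ → (ι → ℤ) → (ι → ℤ) → ℂ := fun S'' S' j l =>
      ((if R S' l then (D S'' S').coeff j (pt q (m + l)) else 0) - (D S'' S').coeff j (pt q m)) *
        (E S' S).coeff l (pt q m)
    have herr0 : ∀ S'' S' j l, j ∉ T → err S'' S' j l = 0 := by
      intro S'' S' j l hj
      simp only [err, hTD S'' S' j hj]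
      simp
    have herr : ∀ S'' S' j l, j ∈ T → l ∈ T → ‖err S'' S' j l‖ ≤ η := by
      intro S'' S' j l hj hl
      refine hq (S'', S', S, ⟨j, hj⟩, ⟨l, hl⟩) m hmr _ ?_
      by_cases hR : R S' l
      · exact Or.inl ⟨hR, if_pos hR⟩
      · exact Or.inr ⟨hR, if_neg hR⟩
    have hent : ∀ x : (Σ S : Λ, (∀ i, Fin (q + d S i))),
        (QM d q D * QM d q E - 1) x ⟨S, y⟩ =
        (∑ S', ∑ l ∈ T, err x.1 S' ((fun i => ((x.2 i : ℕ) : ℤ)) - m - l) l) -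
          (if x.1 = S then H.coeff ((fun i => ((x.2 i : ℕ) : ℤ)) - m) (pt q m) else 0) := by
      rintro ⟨S'', x⟩
      set kx : ι → ℤ := fun i => ((x i : ℕ) : ℤ) with hkx
      have h1 : (QM d q D * QM d q E) ⟨S'', x⟩ ⟨S, y⟩ =
          ∑ S', ∑ l ∈ T, if R S' l then
            (D S'' S').coeff (kx - m - l) (pt q (m + l)) * (E S' S).coeff l (pt q m) else 0 := by
        rw [Matrix.mul_apply, Fintype.sum_sigma]
        refine Finset.sum_congr rfl fun S' _ => ?_
        rw [← sum_inj_eq (fun (k : ∀ i, Fin (q + d S' i)) => (fun i => ((k i : ℕ) : ℤ)) - m) ?_ T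
          (fun l => (D S'' S').coeff (kx - m - l) (pt q (m + l)) * (E S' S).coeff l (pt q m)) ?_
          (R S') ?_]
        · refine Finset.sum_congr rfl fun k _ => ?_
          simp only [QM, Matrix.of_apply]
          have e1 : kx - m - ((fun i => ((k i : ℕ) : ℤ)) - m) = fun i => kx i - ((k i : ℕ) : ℤ) := by
            funext i; simp
          have e2 : m + ((fun i => ((k i : ℕ) : ℤ)) - m) = fun i => ((k i : ℕ) : ℤ) := by
            funext i; simp
          rw [e1, e2]
          rfl
        · intro k k' h
          funext i
          have := congrFun h i
          simp only [Pi.sub_apply, sub_left_inj, Nat.cast_inj] at this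
          exact Fin.ext this
        · intro l hl
          rw [hTE S' S l hl]; simp
        · intro l
          constructor
          · intro h
            refine ⟨fun i => ⟨(m i + l i).toNat, ?_⟩, ?_⟩
            · have := h i
              omega
            · funext i
              have := h i
              simp only [Pi.sub_apply]
              omega
          · rintro ⟨k, rfl⟩ i
            have := (k i).2
            simp only [Pi.sub_apply]
            omega
      have h2 : ((D * E) S'' S).coeff (kx - m) (pt q m) =
          ∑ S', ∑ l ∈ T, (D S'' S').coeff (kx - m - l) (pt q m) * (E S' S).coeff l (pt q m) := by
        rw [Matrix.mul_apply, AddMonoidAlgebra.coeff_sum, Finsupp.finsetSum_apply,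
          ContinuousMap.sum_apply]
        refine Finset.sum_congr rfl fun S' _ => ?_
        rw [coeff_mul_box _ _ T (hTE S' S), ContinuousMap.sum_apply]
        rfl
      have h3 : ((D * E) S'' S).coeff (kx - m) (pt q m) =
          (1 : Matrix (Σ S : Λ, (∀ i, Fin (q + d S i))) (Σ S : Λ, (∀ i, Fin (q + d S i))) ℂ) ⟨S'', x⟩ ⟨S, y⟩ -
            (if S'' = S then H.coeff (kx - m) (pt q m) else 0) := by
        rw [hDE, Matrix.smul_apply, Matrix.one_apply, Matrix.one_apply]
        by_cases hS : S'' = S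
        · subst hS
          rw [if_pos rfl, if_pos rfl, smul_eq_mul, mul_one, AddMonoidAlgebra.coeff_sub,
            Finsupp.sub_apply, ContinuousMap.sub_apply]
          congr 1
          by_cases hxy : x = y
          · subst hxy
            simp [AddMonoidAlgebra.one_def, hkx, hm]
          · have : ¬ (0 = kx - m) := by
              intro h
              apply hxy
              funext i
              have := congrFun h i
              simp only [Pi.sub_apply, Pi.zero_apply, hkx, hm] at this
              apply Fin.ext
              omega
            rw [AddMonoidAlgebra.one_def, AddMonoidAlgebra.coeff_single, Finsupp.single_apply,
              if_neg this, if_neg (by simpa using hxy)]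
            rfl
        · rw [if_neg hS, if_neg hS, if_neg (fun h => hS (congrArg Sigma.fst h))]
          simp
      rw [Matrix.sub_apply, h1, eq_sub_iff_add_eq]
      rw [eq_sub_iff_add_eq] at h3
      rw [← h3, h2]
      simp only [err, sub_mul, Finset.sum_sub_distrib, ite_mul, zero_mul]
      ring
    have hs1 : ∑ x : (Σ S : Λ, (∀ i, Fin (q + d S i))),
        ‖∑ S', ∑ l ∈ T, err x.1 S' ((fun i => ((x.2 i : ℕ) : ℤ)) - m - l) l‖ ≤ M * η := by
      rw [Fintype.sum_sigma]
      calc _ ≤ ∑ S'' : Λ, ∑ S' : Λ, ∑ l ∈ T, ∑ j ∈ T, ‖err S'' S' j l‖ := by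
            refine Finset.sum_le_sum fun S'' _ => ?_
            refine (Finset.sum_le_sum fun k _ => (norm_sum_le _ _).trans
              (Finset.sum_le_sum fun S' _ => norm_sum_le _ _)).trans ?_
            rw [Finset.sum_comm]
            refine Finset.sum_le_sum fun S' _ => ?_
            rw [Finset.sum_comm]
            refine Finset.sum_le_sum fun l _ => ?_
            refine sum_inj_le (fun (k : ∀ i, Fin (q + d S'' i)) =>
              (fun i => ((k i : ℕ) : ℤ)) - m - l) ?_ T (fun j => ‖err S'' S' j l‖)
              (fun _ => norm_nonneg _) (fun j hj => by
                rw [herr0 S'' S' j l hj, norm_zero])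
            intro k k' h
            funext i
            have := congrFun h i
            simp only [Pi.sub_apply, sub_left_inj, Nat.cast_inj] at this
            exact Fin.ext this
        _ ≤ ∑ S'' : Λ, ∑ S' : Λ, ∑ l ∈ T, ∑ j ∈ T, η := by
            refine Finset.sum_le_sum fun S'' _ => Finset.sum_le_sum fun S' _ =>
              Finset.sum_le_sum fun l hl => Finset.sum_le_sum fun j hj => herr _ _ _ _ hj hl
        _ = M * η := by
            simp only [Finset.sum_const, nsmul_eq_mul, Finset.card_univ, hM]
            ring
    have hs2 : ∑ x : (Σ S : Λ, (∀ i, Fin (q + d S i))),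
        ‖(if x.1 = S then H.coeff ((fun i => ((x.2 i : ℕ) : ℤ)) - m) (pt q m) else 0)‖ < 1 / 2 := by
      refine lt_of_le_of_lt ?_ hH
      rw [Fintype.sum_sigma, Finset.sum_eq_single S]
      · simp only [if_true]
        refine (sum_inj_le (fun (k : ∀ i, Fin (q + d S i)) =>
              (fun i => ((k i : ℕ) : ℤ)) - m) ?_ H.coeff.support (fun j => ‖H.coeff j (pt q m)‖)
              (fun _ => norm_nonneg _) (fun j hj => by
                rw [Finsupp.notMem_support_iff.1 hj]; simp)).trans ?_
        · intro k k' h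
          funext i
          have := congrFun h i
          simp only [Pi.sub_apply, sub_left_inj, Nat.cast_inj] at this
          exact Fin.ext this
        · exact Finset.sum_le_sum fun j _ => ContinuousMap.norm_coe_le_norm _ _
      · intro S' _ hS'
        simp [hS']
      · simp
    calc _ ≤ ∑ x : (Σ S : Λ, (∀ i, Fin (q + d S i))),
        (‖∑ S', ∑ l ∈ T, err x.1 S' ((fun i => ((x.2 i : ℕ) : ℤ)) - m - l) l‖ + 
        ‖(if x.1 = S then H.coeff ((fun i => ((x.2 i : ℕ) : ℤ)) - m) (pt q m) else 0)‖) := by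
          refine Finset.sum_le_sum fun x _ => ?_
          rw [hent]
          exact norm_sub_le _ _
      _ < 1 := by
          rw [Finset.sum_add_distrib]
          linarith
  rw [Matrix.det_mul, hdet, zero_mul] at this
  exact this rfl

theorem symm_cases {ι : Type} [DecidableEq ι] (S : Finset ι) (k : ι) :
    (k ∈ S ∧ symmDiff S {k} = S.erase k) ∨ (k ∉ S ∧ symmDiff S {k} = insert k S) := by
  by_cases h : k ∈ S
  · left
    refine ⟨h, ?_⟩
    ext x; by_cases hx : x = k <;> simp [Finset.mem_symmDiff, hx, h]
  · right
    refine ⟨h, ?_⟩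
    ext x; by_cases hx : x = k <;> simp [Finset.mem_symmDiff, hx, h]

theorem kosz_filt {ι : Type} [Fintype ι] [DecidableEq ι] (r : ι → ℕ) (F G : ι → Sy ι)
    (a : ι → ι → ℕ) (hF : ∀ u, Filt (fun i => (a u i : ℤ)) (F u))
    (hG : ∀ u, Filt (fun i => -(a u i : ℤ)) (G u)) (S' S : Finset ι) :
    Filt (fun i => ((∑ k ∈ S', a k i : ℕ) : ℤ) - ((∑ k ∈ S, a k i : ℕ) : ℤ)) (kosz r F G S' S) := by
  unfold kosz
  rw [Matrix.of_apply]
  refine Filt.sum _ _ fun k _ => ?_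
  split_ifs with h1 h2
  · subst h1
    rcases symm_cases S k with ⟨_, h3⟩ | ⟨h3, _⟩
    · refine (Filt.intCast _).mul (hG k) fun i => ?_
      rw [h3, ← Finset.add_sum_erase S _ h2]
      push_cast
      simp
    · exact absurd h2 h3
  · subst h1
    rcases symm_cases S k with ⟨h3, _⟩ | ⟨_, h3⟩
    · exact absurd h3 h2
    · refine (Filt.intCast _).mul (hF k) fun i => ?_
      rw [h3, Finset.sum_insert h2]
      push_cast
      simp
  · exact Filt.zero _

theorem core_par {ι : Type} [Fintype ι] [DecidableEq ι] (r : ι → ℕ) (F G : ι → Sy ι)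
    (a : ι → ι → ℕ) (ha : ∀ u, 1 ≤ a u u) (q : ℕ)
    (hq : (QM (fun (S : Finset ι) i => ∑ k ∈ S, a k i) q (kosz r F G)).det ≠ 0) : False := by
  have hpar := bd_parity (QM (fun (S : Finset ι) i => ∑ k ∈ S, a k i) q (kosz r F G)) (fun x => (-1) ^ x.1.card) (by
    intro x y hxy
    have hne : kosz r F G x.1 y.1 ≠ 0 := by
      intro h0
      apply hxy
      unfold QM
      rw [Matrix.of_apply, h0]
      simp
    unfold kosz at hne
    rw [Matrix.of_apply] at hne
    obtain ⟨k, _, hk⟩ := Finset.exists_ne_zero_of_sum_ne_zero hne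
    have hk' : x.1 = symmDiff y.1 {k} := by
      by_contra h0
      exact hk (if_neg h0)
    rw [hk']
    rcases symm_cases y.1 k with ⟨h3, h4⟩ | ⟨h3, h4⟩
    · rw [h4, ← Finset.card_erase_add_one h3, pow_succ]; ring
    · rw [h4, Finset.card_insert_of_notMem h3, pow_succ]; ring) hq
  rw [Fintype.sum_sigma] at hpar
  apply bd_alt_ne q a ha
  rw [← hpar]
  refine Finset.sum_congr rfl fun S _ => ?_
  simp only [Finset.sum_const, Finset.card_univ, Fintype.card_pi, Fintype.card_fin, nsmul_eq_mul]
  rw [mul_comm]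
  push_cast
  rfl

theorem alg_geom {R : Type} [CommRing R] (cc P h : R) (m : ℕ) (hh : h = 1 - cc * P) :
    (cc * ∑ j ∈ Finset.range m, h ^ j) * P = 1 - h ^ m := by
  rw [← mul_neg_geom_sum h m]
  have h2 : 1 - h = cc * P := by rw [hh, sub_sub_cancel]
  rw [h2]; ring

theorem core_inv {ι : Type} [Fintype ι] [DecidableEq ι] (P : Sy ι) (hFP : Filt 0 P)
    (φ : (ι → unitInterval) → (ι → Circle) → ℝ) (hevP : ∀ s z, ev s z P = ((φ s z : ℝ) : ℂ))
    (ε C : ℝ) (hε : 0 < ε) (hC : 0 < C) (hlow : ∀ s z, ε ≤ φ s z) (hup : ∀ s z, φ s z ≤ C) :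
    ∃ g H : Sy ι, Filt 0 g ∧ g * P = 1 - H ∧ ∑ k ∈ H.coeff.support, ‖H.coeff k‖ < 1 / 2 := by
  obtain ⟨cc, hevcc, hFcc⟩ : ∃ cc : Sy ι, (∀ s z, ev s z cc = (C : ℂ)⁻¹) ∧ Filt 0 cc := by
    refine ⟨AddMonoidAlgebra.single 0 (ContinuousMap.const _ ((C : ℂ)⁻¹)), ?_, Filt.const _⟩
    intro s z; rw [ev_single]; simp
  obtain ⟨h, hh⟩ : ∃ h : Sy ι, h = 1 - cc * P := ⟨_, rfl⟩
  have hFh : Filt 0 h := by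
    rw [hh, sub_eq_add_neg]
    exact Filt.one.add (Filt.neg (hFcc.mul hFP (by simp)))
  have hevh : ∀ s z, ‖ev s z h‖ ≤ 1 - ε / C := by
    intro s z
    have h1 : ev s z h = ((1 - φ s z / C : ℝ) : ℂ) := by
      rw [hh, map_sub, map_one, map_mul, hevcc, hevP]
      push_cast
      ring
    rw [h1, Complex.norm_real, Real.norm_eq_abs, abs_of_nonneg]
    · have := hlow s z
      gcongr
    · have := hup s z
      rw [sub_nonneg, div_le_one hC]
      exact this
  obtain ⟨m, hm⟩ := small_pow h (1 - ε / C) (by have := div_pos hε hC; linarith) hevh (1 / 2)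
    (by norm_num)
  refine ⟨cc * ∑ j ∈ Finset.range m, h ^ j, h ^ m,
    hFcc.mul (Filt.sum _ _ fun j _ => hFh.pow j) (by simp), ?_, hm⟩
  exact alg_geom cc P h m hh

theorem compact_bounds {X : Type} [TopologicalSpace X] [CompactSpace X] [Nonempty X] (φ : X → ℝ)
    (hφ : Continuous φ) (hpos : ∀ x, 0 < φ x) :
    ∃ ε C : ℝ, 0 < ε ∧ 0 < C ∧ (∀ x, ε ≤ φ x) ∧ (∀ x, φ x ≤ C) := by
  obtain ⟨p0, -, hp0⟩ := isCompact_univ.exists_isMinOn (Set.univ_nonempty) hφ.continuousOn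
  obtain ⟨p1, -, hp1⟩ := isCompact_univ.exists_isMaxOn (Set.univ_nonempty) hφ.continuousOn
  exact ⟨φ p0, φ p1, hpos _, hpos _, fun x => hp0 (Set.mem_univ x), fun x => hp1 (Set.mem_univ x)⟩

theorem kosz_inv {ι R : Type} [Fintype ι] [DecidableEq ι] [CommRing R] (r : ι → ℕ)
    (hr : Function.Injective r) (F G : ι → R) (g H : R) (hg : g * (∑ k, F k * G k) = 1 - H) :
    kosz r F G * (Matrix.of fun S' S => g * kosz r F G S' S) =
      (1 - H) • (1 : Matrix (Finset ι) (Finset ι) R) := by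
  have : (Matrix.of fun S' S => g * kosz r F G S' S) = g • kosz r F G := rfl
  rw [this, Matrix.mul_smul, kosz_sq r hr, smul_smul, hg]

theorem core {ι : Type} [Fintype ι] [DecidableEq ι] (F G : ι → Sy ι)
    (a : ι → ι → ℕ) (ha : ∀ u, 1 ≤ a u u) (hF : ∀ u, Filt (fun i => (a u i : ℤ)) (F u))
    (hG : ∀ u, Filt (fun i => -(a u i : ℤ)) (G u))
    (hFG : ∀ u s z, ev s z (G u) = star (ev s z (F u))) :
    ∃ s z, ∀ u, ev s z (F u) = 0 := by
  by_contra hno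
  push Not at hno
  have hevP : ∀ s z, ev s z (∑ k, F k * G k) = ((∑ u, ‖ev s z (F u)‖ ^ 2 : ℝ) : ℂ) := by
    intro s z
    rw [map_sum]
    push_cast
    refine Finset.sum_congr rfl fun u _ => ?_
    rw [map_mul, hFG]
    exact Complex.mul_conj' _
  have hcont : Continuous (fun p : (ι → unitInterval) × (ι → Circle) =>
      (∑ u, ‖ev p.1 p.2 (F u)‖ ^ 2 : ℝ)) :=
    continuous_finsetSum _ fun u _ => ((ev_continuous (F u)).norm.pow 2)
  obtain ⟨ε, C, hε, hC, hlow, hup⟩ := compact_bounds _ hcont (by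
    intro p
    obtain ⟨u, hu⟩ := hno p.1 p.2
    refine Finset.sum_pos' (fun _ _ => by positivity) ⟨u, Finset.mem_univ _, ?_⟩
    have := norm_pos_iff.2 hu
    positivity)
  have hFP : Filt 0 (∑ k, F k * G k) := Filt.sum _ _ fun k _ => (hF k).mul (hG k) (by simp)
  obtain ⟨g, H, hFg, hPg, hH⟩ := core_inv (∑ k, F k * G k) hFP _ hevP ε C hε hC (fun s z => hlow (s, z)) (fun s z => hup (s, z))
  obtain ⟨r, hr⟩ : ∃ r : ι → ℕ, Function.Injective r :=
    ⟨fun i => (Fintype.equivFin ι i : ℕ), fun i j hij =>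
      (Fintype.equivFin ι).injective (Fin.ext hij)⟩
  obtain ⟨q, hq⟩ := quant (fun (S : Finset ι) i => ∑ k ∈ S, a k i) (kosz r F G)
    (Matrix.of fun S' S => g * kosz r F G S' S) H
    (fun S' S => by
      rw [Matrix.of_apply]
      exact hFg.mul (kosz_filt r F G a hF hG S' S) (by simp))
    (kosz_inv r hr F G g H hPg)
    hH
  exact core_par r F G a ha q hq

/-- Parameter space. -/
abbrev Pm (ι : Type) := (ι → unitInterval) × (ι → Circle)

/-- Functions which are symbols of weight `a`. -/
def SymSet {ι : Type} [Fintype ι] (a : ι → ℤ) : Set C(Pm ι, ℂ) :=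
  {f | ∃ P : Sy ι, Filt a P ∧ ∀ p : Pm ι, ev p.1 p.2 P = f p}

/-- Uniform limits of symbols of weight `a`. -/
def AS {ι : Type} [Fintype ι] (a : ι → ℤ) : Set C(Pm ι, ℂ) := closure (SymSet a)

theorem AS.add {ι : Type} [Fintype ι] {a : ι → ℤ} {f g : C(Pm ι, ℂ)} (hf : f ∈ AS a)
    (hg : g ∈ AS a) : f + g ∈ AS a := by
  refine map_mem_closure₂ continuous_add hf hg ?_
  rintro f ⟨P, hP, hf⟩ g ⟨Q, hQ, hg⟩
  exact ⟨P + Q, hP.add hQ, fun p => by rw [map_add, hf, hg]; rfl⟩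

theorem AS.mul {ι : Type} [Fintype ι] {a b c : ι → ℤ} {f g : C(Pm ι, ℂ)} (hf : f ∈ AS a)
    (hg : g ∈ AS b) (hc : ∀ i, c i = a i + b i) : f * g ∈ AS c := by
  refine map_mem_closure₂ continuous_mul hf hg ?_
  rintro f ⟨P, hP, hf⟩ g ⟨Q, hQ, hg⟩
  exact ⟨P * Q, hP.mul hQ hc, fun p => by rw [map_mul, hf, hg]; rfl⟩

theorem AS.zero {ι : Type} [Fintype ι] (a : ι → ℤ) : (0 : C(Pm ι, ℂ)) ∈ AS a :=
  subset_closure ⟨0, Filt.zero a, fun p => by rw [map_zero]; rfl⟩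

theorem AS.single {ι : Type} [Fintype ι] {a : ι → ℤ} (k : ι → ℤ) (c : Cf ι) (f : C(Pm ι, ℂ))
    (h0 : ∀ i, k i ≠ 0 → ∀ s : ι → unitInterval, s i = 0 → c s = 0)
    (h1 : ∀ i, k i ≠ a i → ∀ s : ι → unitInterval, s i = 1 → c s = 0)
    (hf : ∀ p : Pm ι, f p = c p.1 * ∏ i, (p.2 i : ℂ) ^ k i) : f ∈ AS a := by
  classical
  refine subset_closure ⟨AddMonoidAlgebra.single k c, ?_, fun p => by rw [ev_single, hf]⟩
  intro k' i s
  rw [AddMonoidAlgebra.coeff_single, Finsupp.single_apply]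
  split_ifs with h
  · subst h
    exact ⟨fun hs hk => h0 i hk s hs, fun hs hk => h1 i hk s hs⟩
  · simp

theorem AS.const {ι : Type} [Fintype ι] (c : ℂ) : ContinuousMap.const (Pm ι) c ∈ AS 0 :=
  AS.single 0 (ContinuousMap.const _ c) _ (by simp) (by simp) (by simp)

theorem AS.one {ι : Type} [Fintype ι] : (1 : C(Pm ι, ℂ)) ∈ AS 0 := AS.const 1

theorem AS.sum {ι β : Type} [Fintype ι] {a : ι → ℤ} (T : Finset β) (f : β → C(Pm ι, ℂ))
    (h : ∀ b ∈ T, f b ∈ AS a) : (∑ b ∈ T, f b) ∈ AS a := by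
  classical
  induction T using Finset.induction_on with
  | empty => simpa using AS.zero a
  | insert x T hx ih =>
    rw [Finset.sum_insert hx]
    exact AS.add (h x (Finset.mem_insert_self _ _)) (ih fun b hb => h b (Finset.mem_insert_of_mem hb))

theorem AS.prod {ι β : Type} [Fintype ι] (a : β → ι → ℤ) (T : Finset β) (f : β → C(Pm ι, ℂ))
    (h : ∀ b ∈ T, f b ∈ AS (a b)) : (∏ b ∈ T, f b) ∈ AS (∑ b ∈ T, a b) := by
  classical
  induction T using Finset.induction_on with
  | empty => simpa using AS.one
  | insert x T hx ih =>
    rw [Finset.prod_insert hx, Finset.sum_insert hx]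
    exact AS.mul (h x (Finset.mem_insert_self _ _))
      (ih fun b hb => h b (Finset.mem_insert_of_mem hb)) (fun i => rfl)

theorem sym_star {ι : Type} [Fintype ι] {a : ι → ℤ} (P : Sy ι) (hP : Filt a P) :
    ∃ Q : Sy ι, Filt (fun i => - a i) Q ∧ ∀ s z, ev s z Q = star (ev s z P) := by
  classical
  refine ⟨∑ k ∈ P.coeff.support, AddMonoidAlgebra.single (-k) (star (P.coeff k)), ?_, ?_⟩
  · refine Filt.sum _ _ fun k _ => ?_
    intro k' i s
    rw [AddMonoidAlgebra.coeff_single, Finsupp.single_apply]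
    split_ifs with h
    · subst h
      simp only [ContinuousMap.star_apply, star_eq_zero]
      refine ⟨fun hs hk => (hP k i s).1 hs (by simpa using hk),
        fun hs hk => (hP k i s).2 hs (by simpa using hk)⟩
    · simp
  · intro s z
    rw [map_sum, ev_apply, star_sum]
    refine Finset.sum_congr rfl fun k _ => ?_
    rw [ev_single, ContinuousMap.star_apply, star_mul', star_prod]
    congr 1
    refine Finset.prod_congr rfl fun i _ => ?_
    rw [star_zpow₀]
    rw [Pi.neg_apply, _root_.zpow_neg, ← _root_.inv_zpow]
    congr 1
    rw [← Circle.coe_inv, Circle.coe_inv_eq_conj]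
    rfl

theorem AS.star {ι : Type} [Fintype ι] {f : C(Pm ι, ℂ)} (hf : f ∈ AS 0) : star f ∈ AS 0 := by
  refine map_mem_closure continuous_star hf ?_
  rintro f ⟨P, hP, hf⟩
  obtain ⟨Q, hQ, hQP⟩ := sym_star P hP
  exact ⟨Q, hQ.congr (by simp), fun p => by rw [hQP, hf]; rfl⟩

theorem AS.congr {ι : Type} [Fintype ι] {a b : ι → ℤ} {f : C(Pm ι, ℂ)} (hf : f ∈ AS a)
    (h : ∀ i, a i = b i) : f ∈ AS b := by
  rwa [← funext h]

theorem core2 {ι : Type} [Fintype ι] [DecidableEq ι] (F : ι → C(Pm ι, ℂ))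
    (a : ι → ι → ℕ) (ha : ∀ u, 1 ≤ a u u) (hF : ∀ u, F u ∈ AS (fun i => (a u i : ℤ))) :
    ∃ p, ∀ u, F u p = 0 := by
  by_contra hno
  push Not at hno
  have hcont : Continuous (fun p : Pm ι => (∑ u, ‖F u p‖ : ℝ)) :=
    continuous_finsetSum _ fun u _ => (F u).continuous.norm
  obtain ⟨ε, C, hε, -, hlow, -⟩ := compact_bounds _ hcont (by
    intro p
    obtain ⟨u, hu⟩ := hno p
    refine Finset.sum_pos' (fun _ _ => by positivity) ⟨u, Finset.mem_univ _, ?_⟩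
    exact norm_pos_iff.2 hu)
  set δ : ℝ := ε / (Fintype.card ι + 1) with hδ
  have hδ0 : 0 < δ := by positivity
  have hap : ∀ u, ∃ P : Sy ι, Filt (fun i => (a u i : ℤ)) P ∧ ∀ p : Pm ι,
      ‖F u p - ev p.1 p.2 P‖ ≤ δ := by
    intro u
    obtain ⟨g, ⟨P, hP, hPg⟩, hg⟩ := Metric.mem_closure_iff.1 (hF u) δ hδ0
    refine ⟨P, hP, fun p => ?_⟩
    rw [hPg, ← dist_eq_norm]
    exact (ContinuousMap.dist_apply_le_dist p).trans hg.le
  choose P hP hPF using hap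
  choose Q hQ hQP using fun u => sym_star (P u) (hP u)
  obtain ⟨s, z, hz⟩ := core P Q a ha hP hQ hQP
  have h1 := hlow (s, z)
  have h2 : ∑ u, ‖F u (s, z)‖ ≤ ∑ u : ι, δ := by
    refine Finset.sum_le_sum fun u _ => ?_
    have := hPF u (s, z)
    rwa [hz u, sub_zero] at this
  rw [Finset.sum_const, nsmul_eq_mul, Finset.card_univ] at h2
  have h3 : (Fintype.card ι + 1 : ℝ) * δ = ε := by rw [hδ]; field_simp
  linarith

/-- second homogeneous coordinate -/
noncomputable def psi {ι : Type} (i : ι) (b : Fin 2) : C(Pm ι, ℂ) :=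
  if b = 0 then ⟨fun p => ((√(1 - (p.1 i : ℝ)) : ℝ) : ℂ), by fun_prop⟩
  else ⟨fun p => ((√((p.1 i : ℝ)) : ℝ) : ℂ) * (p.2 i : ℂ), by
    refine Continuous.mul (by fun_prop) ?_
    exact continuous_subtype_val.comp ((continuous_apply i).comp continuous_snd)⟩

theorem psi_mem {ι : Type} [Fintype ι] [DecidableEq ι] (i : ι) (b : Fin 2) :
    psi i b ∈ AS (Pi.single i 1) := by
  unfold psi
  split_ifs with hb
  · refine AS.single 0 ⟨fun s => ((√(1 - (s i : ℝ)) : ℝ) : ℂ), by fun_prop⟩ _ (by simp) ?_ (by simp)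
    intro i' h s hs
    have : i' = i := by
      by_contra h'
      exact h (by simp [h'])
    subst this
    simp [hs]
  · refine AS.single (Pi.single i 1) ⟨fun s => ((√((s i : ℝ)) : ℝ) : ℂ), by fun_prop⟩ _ ?_
      (by simp) ?_
    · intro i' h s hs
      have : i' = i := by
        by_contra h'
        exact h (by simp [h'])
      subst this
      simp [hs]
    · intro p
      simp only [ContinuousMap.coe_mk]
      congr 1
      rw [Finset.prod_eq_single i]
      · simp
      · intro j _ hj; simp [hj]
      · simp

theorem core3 {ι κ : Type} [Fintype ι] [DecidableEq ι] [Fintype κ] (σ : κ → ι)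
    (hσ : Function.Injective σ) (F : κ → C(Pm ι, ℂ))
    (a : κ → ι → ℕ) (ha : ∀ k, 1 ≤ a k (σ k)) (hF : ∀ k, F k ∈ AS (fun i => (a k i : ℤ))) :
    ∃ p, ∀ k, F k p = 0 := by
  classical
  obtain ⟨p, hp⟩ := core2 (fun u => if h : ∃ k, σ k = u then F h.choose else psi u 1)
    (fun u => if h : ∃ k, σ k = u then a h.choose else Pi.single u 1) (by
      intro u
      split_ifs with h
      · have := ha h.choose
        rwa [h.choose_spec] at this
      · simp) (by
      intro u
      split_ifs with h
      · exact hF _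
      · refine AS.congr (psi_mem u 1) fun i => ?_
        by_cases hi : i = u
        · subst hi; simp
        · simp [hi])
  refine ⟨p, fun k => ?_⟩
  have h := hp (σ k)
  have hex : ∃ k', σ k' = σ k := ⟨k, rfl⟩
  simp only [hex, dif_pos] at h
  rwa [hσ hex.choose_spec] at h

instance : CompactSpace TwoSphere :=
  inferInstanceAs (CompactSpace (Metric.sphere (0 : EuclideanSpace ℝ (Fin 3)) 1))

/-- Parametrisation of the sphere. -/
noncomputable def sph (s : unitInterval) (z : Circle) : TwoSphere :=
  ⟨!₂[2 * (√(1 - (s : ℝ)) * √(s : ℝ)) * (z : ℂ).re, 2 * (√(1 - (s : ℝ)) * √(s : ℝ)) * (z : ℂ).im,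
    1 - 2 * (s : ℝ)], by
    rw [mem_sphere_zero_iff_norm, EuclideanSpace.norm_eq, Real.sqrt_eq_one, Fin.sum_univ_three]
    simp only [Real.norm_eq_abs, sq_abs]
    have hz : (z : ℂ).re ^ 2 + (z : ℂ).im ^ 2 = 1 := by
      have := Circle.normSq_coe z
      rw [Complex.normSq_apply] at this
      linarith
    have h1 := Real.sq_sqrt (show (0 : ℝ) ≤ 1 - (s : ℝ) from sub_nonneg.2 s.2.2)
    have h2 := Real.sq_sqrt (show (0 : ℝ) ≤ (s : ℝ) from s.2.1)
    change (2 * (√(1 - (s : ℝ)) * √(s : ℝ)) * (z : ℂ).re) ^ 2 +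
      (2 * (√(1 - (s : ℝ)) * √(s : ℝ)) * (z : ℂ).im) ^ 2 + (1 - 2 * (s : ℝ)) ^ 2 = 1
    have : (2 * (√(1 - (s : ℝ)) * √(s : ℝ)) * (z : ℂ).re) ^ 2 +
      (2 * (√(1 - (s : ℝ)) * √(s : ℝ)) * (z : ℂ).im) ^ 2 =
      4 * (√(1 - (s : ℝ)) ^ 2 * √(s : ℝ) ^ 2) * ((z : ℂ).re ^ 2 + (z : ℂ).im ^ 2) := by ring
    rw [this, hz, h1, h2]
    ring⟩

theorem sph_0 (s : unitInterval) (z : Circle) :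
    (sph s z).1 0 = 2 * (√(1 - (s : ℝ)) * √(s : ℝ)) * (z : ℂ).re := rfl
theorem sph_1 (s : unitInterval) (z : Circle) :
    (sph s z).1 1 = 2 * (√(1 - (s : ℝ)) * √(s : ℝ)) * (z : ℂ).im := rfl
theorem sph_2 (s : unitInterval) (z : Circle) : (sph s z).1 2 = 1 - 2 * (s : ℝ) := rfl

theorem sph_continuous : Continuous (fun p : unitInterval × Circle => sph p.1 p.2) := by
  refine Continuous.subtype_mk ?_ _
  have hz : Continuous fun p : unitInterval × Circle => (p.2 : ℂ) :=
    continuous_subtype_val.comp continuous_snd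
  have hr := Complex.continuous_re.comp hz
  have hi := Complex.continuous_im.comp hz
  refine (PiLp.continuous_toLp 2 _).comp ?_
  refine continuous_pi fun i => ?_
  fin_cases i
  · exact (by fun_prop : Continuous fun p : unitInterval × Circle =>
      2 * (√(1 - (p.1 : ℝ)) * √(p.1 : ℝ))).mul hr
  · exact (by fun_prop : Continuous fun p : unitInterval × Circle =>
      2 * (√(1 - (p.1 : ℝ)) * √(p.1 : ℝ))).mul hi
  · exact (by fun_prop : Continuous fun p : unitInterval × Circle =>
      1 - 2 * (p.1 : ℝ))

/-- Parametrisation of the product of spheres. -/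
noncomputable def xmap {ι : Type} {N : ℕ} (ε : Fin N → ι) : C(Pm ι, Fin N → TwoSphere) :=
  ⟨fun p i => sph (p.1 (ε i)) (p.2 (ε i)), by
    refine continuous_pi fun i => ?_
    exact sph_continuous.comp (by fun_prop : Continuous fun p : Pm ι => (p.1 (ε i), p.2 (ε i)))⟩

theorem xmap_apply {ι : Type} {N : ℕ} (ε : Fin N → ι) (p : Pm ι) (i : Fin N) :
    xmap ε p i = sph (p.1 (ε i)) (p.2 (ε i)) := rfl

theorem sphere_coord_continuous (k : Fin 3) : Continuous fun x : TwoSphere => x.1 k := by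
  have h1 : Continuous fun x : TwoSphere => x.1 := continuous_subtype_val
  exact (PiLp.continuous_apply 2 _ k).comp h1

/-- Those functions which pull back to limits of symbols. -/
noncomputable def goodAlg {ι : Type} [Fintype ι] {N : ℕ} (ε : Fin N → ι) :
    StarSubalgebra ℂ C(Fin N → TwoSphere, ℂ) where
  carrier := {f | f.comp (xmap ε) ∈ AS 0}
  mul_mem' {f g} hf hg := by
    have : (f * g).comp (xmap ε) = f.comp (xmap ε) * g.comp (xmap ε) := rfl
    simp only [Set.mem_ofPred_eq] at *
    rw [this]
    exact AS.mul hf hg (by simp)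
  add_mem' {f g} hf hg := by
    have : (f + g).comp (xmap ε) = f.comp (xmap ε) + g.comp (xmap ε) := rfl
    simp only [Set.mem_ofPred_eq] at *
    rw [this]
    exact AS.add hf hg
  algebraMap_mem' c := by
    exact AS.const c
  star_mem' {f} hf := by
    have : (star f).comp (xmap ε) = star (f.comp (xmap ε)) := rfl
    simp only [Set.mem_ofPred_eq] at *
    rw [this]
    exact AS.star hf

theorem good_top {ι : Type} [Fintype ι] [DecidableEq ι] {N : ℕ} (ε : Fin N → ι)
    (f : C(Fin N → TwoSphere, ℂ)) : f.comp (xmap ε) ∈ AS 0 := by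
  have hclosed : IsClosed ((goodAlg ε : StarSubalgebra ℂ C(Fin N → TwoSphere, ℂ)) :
      Set C(Fin N → TwoSphere, ℂ)) :=
    isClosed_closure.preimage (ContinuousMap.continuous_precomp (xmap ε))
  have hsep : (goodAlg ε).SeparatesPoints := by
    intro x y hxy
    by_contra hno
    apply hxy
    have hall : ∀ g : C(Fin N → TwoSphere, ℂ), g.comp (xmap ε) ∈ AS 0 → g x = g y := by
      intro g hg
      by_contra hne
      exact hno ⟨g, ⟨g, hg, rfl⟩, hne⟩
    funext i
    have h2 := hall ⟨fun x => (((x i).1 2 : ℝ) : ℂ), Complex.continuous_ofReal.comp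
        ((sphere_coord_continuous 2).comp (continuous_apply i))⟩ (by
      refine AS.single 0 ⟨fun s => ((1 - 2 * (s (ε i) : ℝ) : ℝ) : ℂ), by fun_prop⟩ _ (by simp)
        (by simp) ?_
      intro p
      simp [xmap_apply, sph_2])
    have h01 := hall ⟨fun x => (((x i).1 0 : ℝ) : ℂ) + (((x i).1 1 : ℝ) : ℂ) * Complex.I,
        (Complex.continuous_ofReal.comp
        ((sphere_coord_continuous 0).comp (continuous_apply i))).add ((Complex.continuous_ofReal.comp
        ((sphere_coord_continuous 1).comp (continuous_apply i))).mul continuous_const)⟩ (by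
      refine AS.single (Pi.single (ε i) 1) ⟨fun s =>
        ((2 * (√(1 - (s (ε i) : ℝ)) * √(s (ε i) : ℝ)) : ℝ) : ℂ), by fun_prop⟩ _ ?_ ?_ ?_
      · intro i' h s hs
        have : i' = ε i := by
          by_contra h'
          exact h (by simp [h'])
        subst this
        simp [hs]
      · intro i' h s hs
        have : i' = ε i := by
          by_contra h'
          exact h (by simp [h'])
        subst this
        simp [hs]
      · intro p
        simp only [ContinuousMap.comp_apply, ContinuousMap.coe_mk, xmap_apply, sph_0, sph_1]
        rw [Finset.prod_eq_single (ε i) (by intro j _ hj; simp [hj]) (by simp)]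
        simp only [Pi.single_eq_same, zpow_one]
        conv_rhs => rw [← Complex.re_add_im (p.2 (ε i) : ℂ)]
        push_cast
        ring)
    simp only [ContinuousMap.coe_mk] at h2 h01
    have h2' : (x i).1 2 = (y i).1 2 := by exact_mod_cast h2
    have h0' := congrArg Complex.re h01
    have h1' := congrArg Complex.im h01
    simp at h0' h1'
    apply Subtype.ext
    ext k
    fin_cases k
    · exact h0'
    · exact h1'
    · exact h2'
  have h := ContinuousMap.starSubalgebra_topologicalClosure_eq_top_of_separatesPoints (goodAlg ε) hsep
  have hf : f ∈ (goodAlg ε).topologicalClosure := by rw [h]; trivial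
  have hf2 : f ∈ closure ((goodAlg ε : StarSubalgebra ℂ C(Fin N → TwoSphere, ℂ)) :
      Set C(Fin N → TwoSphere, ℂ)) := hf
  rw [hclosed.closure_eq] at hf2
  exact hf2

theorem bott_psi {ι : Type} (p : Pm ι) (i : ι) (a b : Fin 2) :
    bott (sph (p.1 i) (p.2 i)) a b = psi i a p * star (psi i b p) := by
  have h1 : (((√(1 - (p.1 i : ℝ)) : ℝ) : ℂ)) ^ 2 = 1 - ((p.1 i : ℝ) : ℂ) := by
    have := Real.sq_sqrt (show (0 : ℝ) ≤ 1 - (p.1 i : ℝ) from sub_nonneg.2 (p.1 i).2.2)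
    exact_mod_cast congrArg (fun r : ℝ => (r : ℂ)) this
  have h2 : (((√((p.1 i : ℝ)) : ℝ) : ℂ)) ^ 2 = ((p.1 i : ℝ) : ℂ) := by
    have := Real.sq_sqrt (show (0 : ℝ) ≤ (p.1 i : ℝ) from (p.1 i).2.1)
    exact_mod_cast congrArg (fun r : ℝ => (r : ℂ)) this
  have hz : (p.2 i : ℂ) * star (p.2 i : ℂ) = 1 := by
    have := Complex.mul_conj (p.2 i : ℂ)
    rw [Circle.normSq_coe] at this
    simpa using this
  have hz1 : (p.2 i : ℂ) = ((p.2 i : ℂ).re : ℂ) + ((p.2 i : ℂ).im : ℂ) * Complex.I :=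
    (Complex.re_add_im _).symm
  have hz2 : star (p.2 i : ℂ) = ((p.2 i : ℂ).re : ℂ) - ((p.2 i : ℂ).im : ℂ) * Complex.I := by
    apply Complex.ext <;> simp
  have hr : ∀ r : ℝ, star (r : ℂ) = r := fun r => Complex.conj_ofReal r
  unfold bott psi
  fin_cases a <;> fin_cases b <;>
    simp only [Matrix.smul_apply, sph_0, sph_1, sph_2, Fin.zero_eta, Fin.mk_one, Matrix.of_apply,
      Matrix.cons_val_zero, Matrix.cons_val_one, smul_eq_mul, if_true, one_ne_zero, if_false,
      ContinuousMap.coe_mk, star_mul', hr]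
  · push_cast
    linear_combination -h1
  · rw [hz2]
    push_cast
    ring
  · conv_rhs => rw [hz1]
    push_cast
    ring
  · push_cast
    linear_combination - h2 * ((p.2 i : ℂ) * star (p.2 i : ℂ)) - ((p.1 i : ℝ) : ℂ) * hz

theorem bott_herm (v : TwoSphere) : (bott v)ᴴ = bott v := by
  have hr : ∀ r : ℝ, star (r : ℂ) = r := fun r => Complex.conj_ofReal r
  have hI : star Complex.I = - Complex.I := Complex.conj_I
  unfold bott
  ext a b
  rw [Matrix.conjTranspose_apply]
  fin_cases a <;> fin_cases b <;>
    simp [hr, hI] <;> ring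

theorem triv_herm : trivFactorᴴ = trivFactor := by
  ext a b
  rw [Matrix.conjTranspose_apply]
  unfold trivFactor
  fin_cases a <;> fin_cases b <;> simp

theorem bottProj_herm (N : ℕ) (J : Finset (Fin N)) (x : Fin N → TwoSphere) :
    (bottProj N J x)ᴴ = bottProj N J x := by
  ext a b
  rw [Matrix.conjTranspose_apply]
  unfold bottProj
  rw [Matrix.of_apply, Matrix.of_apply, star_prod]
  refine Finset.prod_congr rfl fun i _ => ?_
  split_ifs
  · rw [← Matrix.conjTranspose_apply, bott_herm]
  · rw [← Matrix.conjTranspose_apply, triv_herm]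

theorem fProj_herm (N j t : ℕ) (ns : Fin j → ℕ)
    (J : (s : Fin j) → Fin (ns s) → Finset (Fin N)) (x : Fin N → TwoSphere) :
    (fProj N j t ns J x)ᴴ = fProj N j t ns J x := by
  unfold fProj
  rw [Matrix.fromBlocks_conjTranspose, Matrix.blockDiagonal'_conjTranspose]
  simp only [Matrix.blockDiagonal_conjTranspose, bottProj_herm, Matrix.conjTranspose_zero,
    Matrix.conjTranspose_one]

/-- The multiple `n·f`. -/
noncomputable abbrev nf (N j t n : ℕ) (ns : Fin j → ℕ)
    (J : (s : Fin j) → Fin (ns s) → Finset (Fin N)) (x : Fin N → TwoSphere) :=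
  Matrix.blockDiagonal fun _ : Fin n => fProj N j t ns J x

theorem nf_herm (N j t n : ℕ) (ns : Fin j → ℕ)
    (J : (s : Fin j) → Fin (ns s) → Finset (Fin N)) (x : Fin N → TwoSphere) :
    (nf N j t n ns J x)ᴴ = nf N j t n ns J x := by
  unfold nf
  rw [Matrix.blockDiagonal_conjTranspose]
  simp only [fProj_herm]

theorem nf_inl (N j t n : ℕ) (ns : Fin j → ℕ)
    (J : (s : Fin j) → Fin (ns s) → Finset (Fin N)) (x : Fin N → TwoSphere)
    (w : ((Σ s : Fin j, (Fin N → Fin 2) × Fin (ns s)) ⊕ Fin t) × Fin n → ℂ)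
    (s : Fin j) (α : Fin (ns s)) (a : Fin N → Fin 2) (ν : Fin n) :
    (nf N j t n ns J x *ᵥ w) (Sum.inl ⟨s, (a, α)⟩, ν) =
      ∑ b, bottProj N (J s α) x a b * w (Sum.inl ⟨s, (b, α)⟩, ν) := by
  rw [Matrix.mulVec, dotProduct, Fintype.sum_prod_type]
  simp only [nf, Matrix.blockDiagonal_apply, ite_mul, zero_mul, Finset.sum_ite_eq,
    Finset.mem_univ, if_true]
  rw [Fintype.sum_sum_type]
  unfold fProj
  simp only [Matrix.fromBlocks_apply₁₁, Matrix.fromBlocks_apply₁₂, Matrix.zero_apply, zero_mul,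
    Finset.sum_const_zero, add_zero]
  rw [Fintype.sum_sigma, Finset.sum_eq_single s]
  · simp only [Matrix.blockDiagonal'_apply_eq]
    rw [Fintype.sum_prod_type]
    simp only [Matrix.blockDiagonal_apply, ite_mul, zero_mul, Finset.sum_ite_eq,
      Finset.mem_univ, if_true]
  · intro s' _ hs'
    refine Finset.sum_eq_zero fun b _ => ?_
    rw [Matrix.blockDiagonal'_apply_ne _ _ _ (Ne.symm hs'), zero_mul]
  · simp

theorem nf_inr (N j t n : ℕ) (ns : Fin j → ℕ)
    (J : (s : Fin j) → Fin (ns s) → Finset (Fin N)) (x : Fin N → TwoSphere)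
    (w : ((Σ s : Fin j, (Fin N → Fin 2) × Fin (ns s)) ⊕ Fin t) × Fin n → ℂ)
    (τ : Fin t) (ν : Fin n) :
    (nf N j t n ns J x *ᵥ w) (Sum.inr τ, ν) = w (Sum.inr τ, ν) := by
  rw [Matrix.mulVec, dotProduct, Fintype.sum_prod_type]
  simp only [nf, Matrix.blockDiagonal_apply, ite_mul, zero_mul, Finset.sum_ite_eq,
    Finset.mem_univ, if_true]
  rw [Fintype.sum_sum_type]
  unfold fProj
  simp only [Matrix.fromBlocks_apply₂₁, Matrix.fromBlocks_apply₂₂, Matrix.zero_apply, zero_mul,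
    Finset.sum_const_zero, zero_add, Matrix.one_apply, ite_mul, one_mul, Finset.sum_ite_eq,
    Finset.mem_univ, if_true]

/-- Index set of trivial summands. -/
abbrev C0 (j t n : ℕ) (ns : Fin j → ℕ) :=
  (Σ k : (Σ s : Fin j, Fin (ns s)), Fin (n - ((k.1 : ℕ) + 1))) ⊕ (Fin t × Fin n)

theorem C0_card (j t n : ℕ) (ns : Fin j → ℕ) :
    Fintype.card (C0 j t n ns) = (∑ s : Fin j, ns s * (n - ((s : ℕ) + 1))) + n * t := by
  rw [Fintype.card_sum, Fintype.card_sigma, Fintype.sum_sigma, Fintype.card_prod]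
  simp [mul_comm]

/-- section of the tensor product of Hopf bundles -/
noncomputable def Psi {ι : Type} {N : ℕ} (ε : Fin N → ι) (J : Finset (Fin N)) (a : Fin N → Fin 2) :
    C(Pm ι, ℂ) := ∏ i, (if i ∈ J then psi (ε i) (a i) else if a i = 0 then 1 else 0)

theorem Psi_mem {ι : Type} [Fintype ι] [DecidableEq ι] {N : ℕ} (ε : Fin N → ι)
    (J : Finset (Fin N)) (a : Fin N → Fin 2) :
    Psi ε J a ∈ AS (∑ i, if i ∈ J then Pi.single (ε i) 1 else 0) := by
  refine AS.prod _ _ _ fun i _ => ?_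
  split_ifs
  · exact psi_mem _ _
  · exact AS.one
  · exact AS.zero _

theorem bottProj_Psi {ι : Type} {N : ℕ} (ε : Fin N → ι) (J : Finset (Fin N)) (a b : Fin N → Fin 2)
    (p : Pm ι) : bottProj N J (xmap ε p) a b = Psi ε J a p * star (Psi ε J b p) := by
  unfold bottProj Psi
  rw [Matrix.of_apply, ContinuousMap.prod_apply, ContinuousMap.prod_apply, star_prod,
    ← Finset.prod_mul_distrib]
  refine Finset.prod_congr rfl fun i _ => ?_
  split_ifs with h1 h2 h3 h3
  · rw [xmap_apply, bott_psi]
  all_goals simp [trivFactor, *]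

/-- coefficient of the product of linear forms -/
noncomputable def ee {ι Y : Type} [Fintype Y] [DecidableEq Y] (ε : Y → ι) (r : ℕ) : C(Pm ι, ℂ) :=
  ∑ T : Finset Y, if T.card = r then ∏ y, psi (ε y) (if y ∈ T then 1 else 0) else 0

theorem ee_mem {ι Y : Type} [Fintype ι] [DecidableEq ι] [Fintype Y] [DecidableEq Y] (ε : Y → ι)
    (r : ℕ) : ee ε r ∈ AS (∑ y, Pi.single (ε y) 1) := by
  refine AS.sum _ _ fun T _ => ?_
  split_ifs
  · exact AS.prod _ _ _ fun y _ => psi_mem _ _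
  · exact AS.zero _

theorem ee_ne {ι Y : Type} [Fintype Y] [DecidableEq Y] (ε : Y → ι)
    (p : Pm ι) (c : ℕ) (hc : Fintype.card Y < c) (h : ∀ r : Fin c, ee ε r p = 0) : False := by
  have h1 : (∏ y, (Polynomial.C (psi (ε y) 1 p) * Polynomial.X + Polynomial.C (psi (ε y) 0 p))
      : Polynomial ℂ) = 0 := by
    rw [Finset.prod_add]
    have h2 : ∀ T ∈ (Finset.univ : Finset Y).powerset,
        (∏ y ∈ T, (Polynomial.C (psi (ε y) 1 p) * Polynomial.X)) *
          ∏ y ∈ Finset.univ \ T, Polynomial.C (psi (ε y) 0 p) =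
        ∑ r : Fin c, Polynomial.C (if T.card = r then
          ∏ y, psi (ε y) (if y ∈ T then 1 else 0) p else 0) * Polynomial.X ^ (r : ℕ) := by
      intro T _
      have hT : T.card < c := lt_of_le_of_lt (Finset.card_le_univ T) hc
      rw [Finset.sum_eq_single (⟨T.card, hT⟩ : Fin c)]
      · simp only [if_true]
        rw [Finset.prod_mul_distrib, Finset.prod_const]
        have h3 : ∏ y, psi (ε y) (if y ∈ T then 1 else 0) p =
            (∏ y ∈ T, psi (ε y) 1 p) * ∏ y ∈ Finset.univ \ T, psi (ε y) 0 p := by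
          rw [← Finset.prod_sdiff (Finset.subset_univ T), mul_comm]
          congr 1
          · exact Finset.prod_congr rfl fun y hy => by rw [if_pos hy]
          · exact Finset.prod_congr rfl fun y hy => by rw [if_neg (Finset.mem_sdiff.1 hy).2]
        rw [h3, Polynomial.C_mul, map_prod, map_prod]
        ring
      · intro r _ hr
        rw [if_neg (fun h => hr (Fin.ext h.symm))]
        simp
      · simp
    rw [Finset.sum_congr rfl h2, Finset.sum_comm]
    refine Finset.sum_eq_zero fun r _ => ?_
    rw [← Finset.sum_mul, ← map_sum, Finset.powerset_univ]
    have := h r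
    unfold ee at this
    rw [ContinuousMap.sum_apply] at this
    have h4 : (∑ T : Finset Y, if T.card = (r : ℕ) then
          ∏ y, psi (ε y) (if y ∈ T then 1 else 0) p else 0) = 0 := by
      refine Eq.trans ?_ this
      refine Finset.sum_congr rfl fun T _ => ?_
      split_ifs
      · rw [ContinuousMap.prod_apply]
      · rfl
    rw [h4]; simp
  rw [Finset.prod_eq_zero_iff] at h1
  obtain ⟨y, _, hy⟩ := h1
  have c0 := congrArg (fun P => Polynomial.coeff P 0) hy
  have c1 := congrArg (fun P => Polynomial.coeff P 1) hy
  simp [Polynomial.coeff_C] at c0 c1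
  unfold psi at c0 c1
  simp only [one_ne_zero, if_false, if_true, ContinuousMap.coe_mk] at c0 c1
  have hz := Circle.coe_ne_zero (p.2 (ε y))
  have c1' := (mul_eq_zero.1 c1).resolve_right hz
  have c0'' : √(1 - (p.1 (ε y) : ℝ)) = 0 := by exact_mod_cast c0
  have c1'' : √((p.1 (ε y) : ℝ)) = 0 := by exact_mod_cast c1'
  have h5 := (Real.sqrt_eq_zero (sub_nonneg.2 (p.1 (ε y)).2.2)).1 c0''
  have h6 := (Real.sqrt_eq_zero ((p.1 (ε y)).2.1)).1 c1''
  linarith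

/-- Hall-type injection. -/
def hallMap (N j t n : ℕ) (ns : Fin j → ℕ)
    (J : (s : Fin j) → Fin (ns s) → Finset (Fin N))
    (hcard : ∀ s α, (J s α).card = (s : ℕ) + 1) :
    ((Σ s : Fin j, Fin (ns s)) × Fin n) ⊕ (Fin t × Fin n) → Fin N ⊕ C0 j t n ns
  | Sum.inl (k, ν) => if h : (ν : ℕ) < (k.1 : ℕ) + 1 then
      Sum.inl ((J k.1 k.2).orderEmbOfFin (hcard k.1 k.2) ⟨ν, h⟩)
      else Sum.inr (Sum.inl ⟨k, ⟨(ν : ℕ) - ((k.1 : ℕ) + 1), by have := ν.2; omega⟩⟩)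
  | Sum.inr y => Sum.inr (Sum.inr y)

theorem hallMap_inj (N j t n : ℕ) (ns : Fin j → ℕ)
    (J : (s : Fin j) → Fin (ns s) → Finset (Fin N))
    (hcard : ∀ s α, (J s α).card = (s : ℕ) + 1)
    (hdisj : ∀ s α s' α', (⟨s, α⟩ : Σ s : Fin j, Fin (ns s)) ≠ ⟨s', α'⟩ →
      Disjoint (J s α) (J s' α')) : Function.Injective (hallMap N j t n ns J hcard) := by
  rintro (⟨k, ν⟩ | y) (⟨k', ν'⟩ | y') h
  · unfold hallMap at h
    simp only at h
    split_ifs at h with h1 h2 h2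
    · rw [Sum.inl.injEq] at h
      have hk : k = k' := by
        by_contra hk
        have hd := hdisj k.1 k.2 k'.1 k'.2 hk
        refine Finset.disjoint_left.1 hd (Finset.orderEmbOfFin_mem _ (hcard k.1 k.2) ⟨ν, h1⟩) ?_
        rw [h]
        exact Finset.orderEmbOfFin_mem _ _ _
      subst hk
      have := (RelEmbedding.injective _) h
      rw [Fin.mk.injEq] at this
      rw [Fin.ext this]
    · rw [Sum.inr.injEq, Sum.inl.injEq, Sigma.mk.injEq] at h
      obtain ⟨rfl, h⟩ := h
      have h3 := eq_of_heq h
      rw [Fin.mk.injEq] at h3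
      have : ν = ν' := Fin.ext (by omega)
      rw [this]
  · unfold hallMap at h
    simp only at h
    split_ifs at h
    cases h
  · unfold hallMap at h
    simp only at h
    split_ifs at h
    cases h
  · unfold hallMap at h
    cases h
    rfl

theorem upper (N j t n : ℕ) (ns : Fin j → ℕ)
    (J : (s : Fin j) → Fin (ns s) → Finset (Fin N))
    (hcard : ∀ s α, (J s α).card = (s : ℕ) + 1)
    (hdisj : ∀ s α s' α', (⟨s, α⟩ : Σ s : Fin j, Fin (ns s)) ≠ ⟨s', α'⟩ →
      Disjoint (J s α) (J s' α')) (c : ℕ)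
    (v : (Fin N → TwoSphere) →
      Matrix (((Σ s : Fin j, (Fin N → Fin 2) × Fin (ns s)) ⊕ Fin t) × Fin n) (Fin c) ℂ)
    (hv : Continuous v) (h1 : ∀ x, (v x)ᴴ * v x = 1)
    (h2 : ∀ x, (v x * (v x)ᴴ) * nf N j t n ns J x = v x * (v x)ᴴ) :
    c ≤ Fintype.card (C0 j t n ns) := by
  classical
  by_contra hlt
  push Not at hlt
  let ι := Fin N ⊕ C0 j t n ns
  let vC : (((Σ s : Fin j, (Fin N → Fin 2) × Fin (ns s)) ⊕ Fin t) × Fin n) → Fin c → C(Pm ι, ℂ) :=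
    fun k r => (⟨fun x => v x k r, (continuous_apply r).comp ((continuous_apply k).comp hv)⟩ :
      C(Fin N → TwoSphere, ℂ)).comp (xmap Sum.inl)
  have hvC : ∀ k r, vC k r ∈ AS 0 := fun k r => good_top _ _
  let e : Fin c → C(Pm ι, ℂ) := fun r => ee (Sum.inr : C0 j t n ns → ι) r
  let F : ((Σ s : Fin j, Fin (ns s)) × Fin n) ⊕ (Fin t × Fin n) → C(Pm ι, ℂ) := Sum.elim
    (fun k => ∑ r, ∑ a, Psi Sum.inl (J k.1.1 k.1.2) a *
      (star (vC (Sum.inl ⟨k.1.1, (a, k.1.2)⟩, k.2) r) * e r))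
    (fun k => ∑ r, (star (vC (Sum.inr k.1, k.2) r) * e r))
  let a : ((Σ s : Fin j, Fin (ns s)) × Fin n) ⊕ (Fin t × Fin n) → ι → ℕ := Sum.elim
    (fun k => Sum.elim (fun i => if i ∈ J k.1.1 k.1.2 then 1 else 0) (fun _ => 1))
    (fun k => Sum.elim (fun _ => 0) (fun _ => 1))
  have hes : (∑ y : C0 j t n ns, Pi.single (Sum.inr y : ι) (1 : ℤ) : ι → ℤ) =
      Sum.elim (fun _ => 0) (fun _ => 1) := by
    funext u
    rw [Finset.sum_apply]
    rcases u with i | y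
    · refine Finset.sum_eq_zero fun y _ => ?_
      rw [Pi.single_eq_of_ne (by simp)]
    · rw [Finset.sum_eq_single y]
      · simp
      · intro y' _ hy
        rw [Pi.single_eq_of_ne (fun h => hy.symm (Sum.inr.inj h))]
      · simp
  have hem : ∀ r, e r ∈ AS (Sum.elim (fun _ => 0) (fun _ => 1) : ι → ℤ) := by
    intro r
    rw [← hes]
    exact ee_mem _ _
  have hPs : ∀ J : Finset (Fin N), (∑ i, if i ∈ J then Pi.single (Sum.inl i : ι) (1 : ℤ) else 0 : ι → ℤ) =
      Sum.elim (fun i => if i ∈ J then 1 else 0) (fun _ => 0) := by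
    intro J
    funext u
    rw [Finset.sum_apply]
    rcases u with i | y
    · rw [Finset.sum_eq_single i]
      · split_ifs <;> simp [*]
      · intro i' _ hi
        split_ifs
        · rw [Pi.single_eq_of_ne (fun h => hi.symm (Sum.inl.inj h))]
        · rfl
      · simp
    · refine Finset.sum_eq_zero fun y _ => ?_
      split_ifs
      · rw [Pi.single_eq_of_ne (by simp)]
      · rfl
  obtain ⟨p, hp⟩ := core3 (hallMap N j t n ns J hcard) (hallMap_inj N j t n ns J hcard hdisj)
    F a (by
      rintro (⟨k, ν⟩ | y)
      · unfold hallMap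
        simp only
        split_ifs with h
        · simp only [a, Sum.elim_inl]
          rw [if_pos (Finset.orderEmbOfFin_mem _ _ _)]
        · simp [a]
      · simp [a, hallMap]) (by
      rintro (⟨k, ν⟩ | y)
      · refine AS.sum _ _ fun r _ => AS.sum _ _ fun b _ => ?_
        refine AS.mul (Psi_mem _ _ _) (AS.mul (AS.star (hvC _ _)) (hem r)
          (c := Sum.elim (fun _ => 0) (fun _ => 1)) (by simp)) ?_
        rw [hPs]
        rintro (i | y) <;> simp [a]
      · refine AS.sum _ _ fun r _ => ?_
        refine AS.mul (AS.star (hvC _ _)) (hem r) ?_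
        rintro (i | y) <;> simp [a])
  set x := xmap (Sum.inl : Fin N → ι) p with hx
  set w := v x *ᵥ (fun r => star (e r p)) with hw
  have hqv : nf N j t n ns J x * v x = v x := by
    have h3 := congrArg Matrix.conjTranspose (h2 x)
    rw [Matrix.conjTranspose_mul, Matrix.conjTranspose_mul, Matrix.conjTranspose_conjTranspose,
      nf_herm] at h3
    calc nf N j t n ns J x * v x = nf N j t n ns J x * (v x * (v x)ᴴ) * v x := by
          rw [Matrix.mul_assoc, Matrix.mul_assoc, h1, Matrix.mul_one]
      _ = v x := by rw [h3, Matrix.mul_assoc, h1, Matrix.mul_one]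
  have hqw : nf N j t n ns J x *ᵥ w = w := by
    rw [hw, Matrix.mulVec_mulVec, hqv]
  have hw0 : w = 0 := by
    funext ⟨k, ν⟩
    rcases k with ⟨s, b, α⟩ | τ
    · rw [← hqw, nf_inl]
      simp only [hx, bottProj_Psi]
      have h4 := hp (Sum.inl (⟨s, α⟩, ν))
      simp only [F, Sum.elim_inl, ContinuousMap.sum_apply, ContinuousMap.mul_apply,
        ContinuousMap.star_apply] at h4
      have h5 : ∑ b', Psi Sum.inl (J s α) b p * star (Psi Sum.inl (J s α) b' p) *
          w (Sum.inl ⟨s, (b', α)⟩, ν) = Psi Sum.inl (J s α) b p * star 0 := by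
        rw [← h4, star_sum, Finset.mul_sum]
        simp only [hw, Matrix.mulVec, dotProduct, Finset.mul_sum, star_sum]
        rw [Finset.sum_comm]
        refine Finset.sum_congr rfl fun r _ => Finset.sum_congr rfl fun b' _ => ?_
        simp only [star_mul', star_star]
        simp only [vC, ContinuousMap.comp_apply, ContinuousMap.coe_mk]
        rw [← hx]
        ring
      rw [h5]; simp
    · have h4 := hp (Sum.inr (τ, ν))
      simp only [F, Sum.elim_inr, ContinuousMap.sum_apply, ContinuousMap.mul_apply,
        ContinuousMap.star_apply] at h4
      have h5 : w (Sum.inr τ, ν) = star 0 := by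
        rw [← h4, star_sum]
        simp only [hw, Matrix.mulVec, dotProduct]
        refine Finset.sum_congr rfl fun r _ => ?_
        simp only [star_mul', star_star]
        rfl
      rw [h5]; simp
  have he0 : (fun r => star (e r p)) = 0 := by
    have : (v x)ᴴ *ᵥ w = fun r => star (e r p) := by
      rw [hw, Matrix.mulVec_mulVec, h1, Matrix.one_mulVec]
    rw [← this, hw0, Matrix.mulVec_zero]
  exact ee_ne (Sum.inr : C0 j t n ns → ι) p c hlt fun r => by
    have := congrFun he0 r
    simpa using this

theorem bott_sq (v : TwoSphere) : bott v * bott v = bott v := by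
  have hn : (v.1 0) ^ 2 + (v.1 1) ^ 2 + (v.1 2) ^ 2 = 1 := by
    have h := v.2
    rw [mem_sphere_zero_iff_norm, EuclideanSpace.norm_eq, Real.sqrt_eq_one,
      Fin.sum_univ_three] at h
    simpa only [Real.norm_eq_abs, sq_abs] using h
  have hc : (v.1 0 : ℂ) ^ 2 + (v.1 1 : ℂ) ^ 2 + (v.1 2 : ℂ) ^ 2 = 1 := by
    have h := congrArg (fun r : ℝ => (r : ℂ)) hn
    push_cast at h
    exact h
  have hI := Complex.I_sq
  unfold bott
  ext a b
  rw [Matrix.mul_apply, Fin.sum_univ_two]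
  fin_cases a <;> fin_cases b <;>
    simp only [Matrix.smul_apply, Fin.zero_eta, Fin.mk_one, Matrix.of_apply,
      Matrix.cons_val_zero, Matrix.cons_val_one, smul_eq_mul]
  · linear_combination (1 / 4 : ℂ) * hc - (1 / 4 : ℂ) * (v.1 1 : ℂ) ^ 2 * hI
  · ring
  · ring
  · linear_combination (1 / 4 : ℂ) * hc - (1 / 4 : ℂ) * (v.1 1 : ℂ) ^ 2 * hI

theorem triv_sq : trivFactor * trivFactor = trivFactor := by
  unfold trivFactor
  ext a b
  rw [Matrix.mul_apply, Fin.sum_univ_two]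
  fin_cases a <;> fin_cases b <;> simp

theorem bottProj_sq (N : ℕ) (J : Finset (Fin N)) (x : Fin N → TwoSphere) :
    bottProj N J x * bottProj N J x = bottProj N J x := by
  ext a c
  rw [Matrix.mul_apply]
  unfold bottProj
  simp only [Matrix.of_apply, ← Finset.prod_mul_distrib]
  rw [← Fintype.piFinset_univ, ← Finset.prod_univ_sum (fun _ => Finset.univ)
    (fun i b => (if i ∈ J then bott (x i) else trivFactor) (a i) b *
      (if i ∈ J then bott (x i) else trivFactor) b (c i))]
  refine Finset.prod_congr rfl fun i _ => ?_
  rw [← Matrix.mul_apply]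
  split_ifs
  · rw [bott_sq]
  · rw [triv_sq]

theorem bott_continuous (a b : Fin 2) : Continuous fun v : TwoSphere => bott v a b := by
  have h : ∀ k, Continuous fun v : TwoSphere => ((v.1 k : ℝ) : ℂ) := fun k =>
    Complex.continuous_ofReal.comp (sphere_coord_continuous k)
  have h0 := h 0
  have h1 := h 1
  have h2 := h 2
  unfold bott
  fin_cases a <;> fin_cases b <;>
    simp only [Matrix.smul_apply, Fin.zero_eta, Fin.mk_one, Matrix.of_apply,
      Matrix.cons_val_zero, Matrix.cons_val_one, smul_eq_mul]
  · exact continuous_const.mul (continuous_const.add h2)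
  · exact continuous_const.mul (h0.sub (h1.mul continuous_const))
  · exact continuous_const.mul (h0.add (h1.mul continuous_const))
  · exact continuous_const.mul (continuous_const.sub h2)

theorem bottProj_continuous (N : ℕ) (J : Finset (Fin N)) (a b : Fin N → Fin 2) :
    Continuous fun x => bottProj N J x a b := by
  unfold bottProj
  simp only [Matrix.of_apply]
  refine continuous_finsetProd _ fun i _ => ?_
  split_ifs
  · exact (bott_continuous _ _).comp (continuous_apply i)
  · exact continuous_const

theorem bottProj_supp (N : ℕ) (J : Finset (Fin N)) (x : Fin N → TwoSphere) (a b : Fin N → Fin 2)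
    (h : bottProj N J x a b ≠ 0) : ∑ i, (b i : ℕ) ≤ J.card := by
  have h1 : ∀ i, i ∉ J → b i = 0 := by
    intro i hi
    by_contra hb
    apply h
    unfold bottProj
    rw [Matrix.of_apply]
    refine Finset.prod_eq_zero (Finset.mem_univ i) ?_
    rw [if_neg hi]
    simp [trivFactor, hb]
  rw [← Finset.sum_subset (Finset.subset_univ J) (fun i _ hi => by rw [h1 i hi]; rfl)]
  rw [Finset.card_eq_sum_ones]
  exact Finset.sum_le_sum fun i _ => by omega

theorem bottProj_poly (N : ℕ) (J : Finset (Fin N)) (x : Fin N → TwoSphere) :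
    ∃ a, (∑ b, Polynomial.C (bottProj N J x a b) * Polynomial.X ^ (∑ i, (b i : ℕ)) :
      Polynomial ℂ) ≠ 0 := by
  have hrow : ∀ i, ∃ a : Fin 2, (if i ∈ J then bott (x i) else trivFactor) a a ≠ 0 := by
    intro i
    split_ifs
    · by_contra hno
      push Not at hno
      have h0 := hno 0
      have h1 := hno 1
      unfold bott at h0 h1
      simp only [Matrix.smul_apply, Matrix.of_apply,
        Matrix.cons_val_zero, Matrix.cons_val_one, smul_eq_mul] at h0 h1
      have : (1 : ℂ) = 0 := by linear_combination h0 + h1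
      exact one_ne_zero this
    · exact ⟨0, by simp [trivFactor]⟩
  choose a ha using hrow
  refine ⟨a, ?_⟩
  have h1 : (∑ b, Polynomial.C (bottProj N J x a b) * Polynomial.X ^ (∑ i, (b i : ℕ)) :
      Polynomial ℂ) = ∏ i, ∑ b : Fin 2, Polynomial.C
        ((if i ∈ J then bott (x i) else trivFactor) (a i) b) * Polynomial.X ^ (b : ℕ) := by
    rw [Finset.prod_univ_sum, Fintype.piFinset_univ]
    refine Finset.sum_congr rfl fun b _ => ?_
    unfold bottProj
    rw [Matrix.of_apply, map_prod, Finset.prod_mul_distrib, Finset.prod_pow_eq_pow_sum]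
  rw [h1, Finset.prod_ne_zero_iff]
  intro i _ h0
  apply ha i
  have h2 := congrArg (fun P => Polynomial.coeff P (a i : ℕ)) h0
  simp only [Polynomial.finsetSum_coeff, Polynomial.coeff_C_mul, Polynomial.coeff_X_pow,
    Polynomial.coeff_zero] at h2
  rw [Finset.sum_eq_single (a i)] at h2
  · simpa using h2
  · intro b _ hb
    rw [if_neg (show ¬ ((a i : ℕ) = (b : ℕ)) from fun h => hb (Fin.ext h.symm)), mul_zero]
  · simp

/-- independence within one block -/
theorem block_indep (N : ℕ) (J : Finset (Fin N)) (x : Fin N → TwoSphere) (n m : ℕ)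
    (hm : m = n - J.card) (g : Fin m → ℂ)
    (hg : ∀ (a : Fin N → Fin 2) (ν : Fin n), ∑ ρ : Fin m, g ρ *
      (∑ b, if (∑ i, (b i : ℕ)) + (ρ : ℕ) = (ν : ℕ) then bottProj N J x a b else 0) = 0) :
    ∀ ρ, g ρ = 0 := by
  obtain ⟨a, ha⟩ := bottProj_poly N J x
  have h1 : (∑ ρ : Fin m, Polynomial.C (g ρ) * Polynomial.X ^ (ρ : ℕ)) *
      (∑ b, Polynomial.C (bottProj N J x a b) * Polynomial.X ^ (∑ i, (b i : ℕ)) :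
      Polynomial ℂ) = 0 := by
    ext ν
    have h2 : ((∑ ρ : Fin m, Polynomial.C (g ρ) * Polynomial.X ^ (ρ : ℕ)) *
      (∑ b, Polynomial.C (bottProj N J x a b) * Polynomial.X ^ (∑ i, (b i : ℕ)) :
      Polynomial ℂ)).coeff ν = ∑ ρ : Fin m, g ρ *
      (∑ b, if (∑ i, (b i : ℕ)) + (ρ : ℕ) = ν then bottProj N J x a b else 0) := by
      rw [Finset.sum_mul_sum, Polynomial.finsetSum_coeff]
      refine Finset.sum_congr rfl fun ρ _ => ?_
      rw [Polynomial.finsetSum_coeff, Finset.mul_sum]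
      refine Finset.sum_congr rfl fun b _ => ?_
      have : (Polynomial.C (g ρ) * Polynomial.X ^ (ρ : ℕ) *
        (Polynomial.C (bottProj N J x a b) * Polynomial.X ^ (∑ i, (b i : ℕ))) : Polynomial ℂ) =
        Polynomial.C (g ρ * bottProj N J x a b) * Polynomial.X ^ ((∑ i, (b i : ℕ)) + (ρ : ℕ)) := by
        rw [pow_add, Polynomial.C_mul]; ring
      rw [this, Polynomial.coeff_C_mul, Polynomial.coeff_X_pow]
      by_cases h : (∑ i, (b i : ℕ)) + (ρ : ℕ) = ν
      · rw [if_pos h, if_pos h.symm, mul_one]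
      · rw [if_neg h, if_neg (fun h' => h h'.symm)]; simp
    rw [h2, Polynomial.coeff_zero]
    by_cases hν : ν < n
    · exact hg a ⟨ν, hν⟩
    · refine Finset.sum_eq_zero fun ρ _ => ?_
      rw [Finset.sum_eq_zero, mul_zero]
      intro b _
      split_ifs with h
      · by_contra hne
        have h3 := bottProj_supp N J x a b hne
        have h4 := ρ.2
        generalize (∑ i, (b i : ℕ)) = S at *
        omega
      · rfl
  have h2 := (mul_eq_zero.1 h1).resolve_right ha
  intro ρ
  have h3 := congrArg (fun P => Polynomial.coeff P (ρ : ℕ)) h2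
  simp only [Polynomial.finsetSum_coeff, Polynomial.coeff_C_mul, Polynomial.coeff_X_pow,
    Polynomial.coeff_zero] at h3
  rw [Finset.sum_eq_single ρ] at h3
  · simpa using h3
  · intro b _ hb
    rw [if_neg (fun h => hb (Fin.ext h.symm)), mul_zero]
  · simp

open InnerProductSpace in
theorem gs_continuous {X K : Type*} [TopologicalSpace X] [Fintype K] (c : ℕ)
    (w : X → Fin c → EuclideanSpace ℂ K) (hw : ∀ i, Continuous fun x => w x i)
    (hi : ∀ x, LinearIndependent ℂ (w x)) (m : ℕ) : ∀ r : Fin c, (r : ℕ) = m →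
    Continuous fun x => gramSchmidt ℂ (w x) r := by
  induction m using Nat.strong_induction_on with
  | _ m ih =>
    intro r hr
    simp only [gramSchmidt_def ℂ _ r]
    refine (hw r).sub (continuous_finsetSum _ fun i hir => ?_)
    have hlt : (i : ℕ) < m := by
      rw [← hr]; exact Fin.lt_def.1 ((Finset.mem_Iio (a := r)).1 hir)
    have hc := ih i hlt i rfl
    simp only [Submodule.starProjection_singleton]
    refine Continuous.smul (Continuous.div (hc.inner (hw r))
      (Complex.continuous_ofReal.comp (hc.norm.pow 2)) fun x => ?_) hc
    have := gramSchmidt_ne_zero (𝕜 := ℂ) i (hi x)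
    simpa using this

open InnerProductSpace in
theorem csub_of_indep {X K : Type*} [TopologicalSpace X] [Fintype K] (c : ℕ)
    (w : X → Fin c → K → ℂ) (hw : ∀ i k, Continuous fun x => w x i k)
    (hi : ∀ x, LinearIndependent ℂ (w x)) (q : X → Matrix K K ℂ)
    (hq : ∀ x, (q x)ᴴ = q x) (hqw : ∀ x i, q x *ᵥ w x i = w x i) :
    CSubequiv (fun _ : X => (1 : Matrix (Fin c) (Fin c) ℂ)) q := by
  set W : X → Fin c → EuclideanSpace ℂ K := fun x i => WithLp.toLp 2 (w x i) with hW
  have hWc : ∀ i, Continuous fun x => W x i := fun i =>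
    (PiLp.continuous_toLp 2 _).comp (continuous_pi fun k => hw i k)
  have hWi : ∀ x, LinearIndependent ℂ (W x) := fun x =>
    (hi x).map' (WithLp.linearEquiv 2 ℂ (K → ℂ)).symm.toLinearMap (LinearEquiv.ker _)
  have hnc : ∀ r, Continuous fun x => gramSchmidtNormed ℂ (W x) r := by
    intro r
    have h := gs_continuous c W hWc hWi r r rfl
    unfold gramSchmidtNormed
    refine Continuous.smul (Continuous.inv₀ (Complex.continuous_ofReal.comp h.norm) fun x => ?_) h
    have := gramSchmidt_ne_zero (𝕜 := ℂ) r (hWi x)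
    simpa using this
  have hinv : ∀ x r, q x *ᵥ (gramSchmidtNormed ℂ (W x) r).ofLp
      = (gramSchmidtNormed ℂ (W x) r).ofLp := by
    intro x r
    let S : Submodule ℂ (EuclideanSpace ℂ K) :=
      { carrier := {u | q x *ᵥ u.ofLp = u.ofLp}
        add_mem' := by
          intro a b ha hb
          simp only [Set.mem_ofPred_eq, WithLp.ofLp_add, Matrix.mulVec_add] at *
          rw [ha, hb]
        zero_mem' := by simp
        smul_mem' := by
          intro a b hb
          simp only [Set.mem_ofPred_eq, WithLp.ofLp_smul, Matrix.mulVec_smul] at *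
          rw [hb] }
    have h1 : Submodule.span ℂ (Set.range (W x)) ≤ S := by
      rw [Submodule.span_le]
      rintro _ ⟨i, rfl⟩
      exact hqw x i
    have h2 : gramSchmidtNormed ℂ (W x) r ∈ S := by
      apply h1
      rw [← span_gramSchmidt ℂ (W x), ← span_gramSchmidtNormed_range]
      exact Submodule.subset_span ⟨r, rfl⟩
    exact h2
  refine ⟨fun x => Matrix.of fun k r => (gramSchmidtNormed ℂ (W x) r).ofLp k, ?_, fun x => ⟨?_, ?_⟩⟩
  · refine continuous_matrix fun k r => ?_
    exact (continuous_apply k).comp ((PiLp.continuous_ofLp 2 _).comp (hnc r))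
  · have ho := gramSchmidtNormed_orthonormal (𝕜 := ℂ) (hWi x)
    rw [orthonormal_iff_ite] at ho
    ext a b
    beta_reduce
    rw [Matrix.mul_apply, Matrix.one_apply, ← ho a b, PiLp.inner_apply]
    refine Finset.sum_congr rfl fun k _ => ?_
    simp [mul_comm]
  · set V : Matrix K (Fin c) ℂ := Matrix.of fun k r => (gramSchmidtNormed ℂ (W x) r).ofLp k with hV
    have hqV : q x * V = V := by
      ext k r
      exact congrFun (hinv x r) k
    calc V * Vᴴ * q x = V * (q x * V)ᴴ := by
          rw [Matrix.conjTranspose_mul, hq, Matrix.mul_assoc]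
      _ = V * Vᴴ := by rw [hqV]

open Classical in
/-- The explicit columns. -/
noncomputable def colW (N j t n : ℕ) (ns : Fin j → ℕ)
    (J : (s : Fin j) → Fin (ns s) → Finset (Fin N)) (x : Fin N → TwoSphere) :
    C0 j t n ns → ((Σ s : Fin j, (Fin N → Fin 2) × Fin (ns s)) ⊕ Fin t) × Fin n → ℂ
  | Sum.inl k, (Sum.inl y, ν) =>
      if (⟨y.1, y.2.2⟩ : Σ s : Fin j, Fin (ns s)) = k.1 then
        ∑ b, if (∑ i, (b i : ℕ)) + (k.2 : ℕ) = (ν : ℕ) then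
          bottProj N (J y.1 y.2.2) x y.2.1 b else 0
      else 0
  | Sum.inl _, (Sum.inr _, _) => 0
  | Sum.inr _, (Sum.inl _, _) => 0
  | Sum.inr p, (Sum.inr τ, ν) => if p = (τ, ν) then 1 else 0

theorem colW_continuous (N j t n : ℕ) (ns : Fin j → ℕ)
    (J : (s : Fin j) → Fin (ns s) → Finset (Fin N)) (k) (y) :
    Continuous fun x => colW N j t n ns J x k y := by
  rcases k with k | p <;> rcases y with ⟨y | τ, ν⟩ <;> simp only [colW]
  · split_ifs
    · refine continuous_finsetSum _ fun b _ => ?_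
      split_ifs
      · exact bottProj_continuous _ _ _ _
      · exact continuous_const
    · exact continuous_const
  · exact continuous_const
  · exact continuous_const
  · exact continuous_const

theorem colW_inv (N j t n : ℕ) (ns : Fin j → ℕ)
    (J : (s : Fin j) → Fin (ns s) → Finset (Fin N)) (x) (k) :
    nf N j t n ns J x *ᵥ colW N j t n ns J x k = colW N j t n ns J x k := by
  funext y
  rcases y with ⟨⟨s, a, α⟩ | τ, ν⟩
  · rw [nf_inl]
    rcases k with k | p <;> simp only [colW]
    · split_ifs
      · simp only [Finset.mul_sum]
        rw [Finset.sum_comm]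
        refine Finset.sum_congr rfl fun b _ => ?_
        split_ifs
        · rw [← Matrix.mul_apply, bottProj_sq]
        · simp
      · simp
    · simp
  · rw [nf_inr]

theorem colW_indep (N j t n : ℕ) (ns : Fin j → ℕ)
    (J : (s : Fin j) → Fin (ns s) → Finset (Fin N))
    (hcard : ∀ s α, (J s α).card = (s : ℕ) + 1) (x) :
    LinearIndependent ℂ (colW N j t n ns J x) := by
  rw [Fintype.linearIndependent_iff]
  intro g hg
  have hg' : ∀ y, ∑ k, g k * colW N j t n ns J x k y = 0 := by
    intro y
    have := congrFun hg y
    simpa [Finset.sum_apply] using this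
  have hl : ∀ s α, ∀ ρ, g (Sum.inl ⟨⟨s, α⟩, ρ⟩) = 0 := by
    intro s α
    refine block_indep N (J s α) x n _ (by rw [hcard]) (fun ρ => g (Sum.inl ⟨⟨s, α⟩, ρ⟩)) ?_
    intro a ν
    have h := hg' (Sum.inl ⟨s, (a, α)⟩, ν)
    rw [Fintype.sum_sum_type, Fintype.sum_sigma] at h
    simp only [colW, mul_zero, Finset.sum_const_zero, add_zero] at h
    rw [Finset.sum_eq_single (⟨s, α⟩ : Σ s : Fin j, Fin (ns s))] at h
    · simpa using h
    · intro k _ hk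
      simp [Ne.symm hk]
    · simp
  have hr : ∀ p, g (Sum.inr p) = 0 := by
    rintro ⟨τ, ν⟩
    have h := hg' (Sum.inr τ, ν)
    rw [Fintype.sum_sum_type] at h
    simpa [colW] using h
  rintro (⟨⟨s, α⟩, ρ⟩ | p)
  · exact hl s α ρ
  · exact hr p

theorem lower (N j t n : ℕ) (ns : Fin j → ℕ)
    (J : (s : Fin j) → Fin (ns s) → Finset (Fin N))
    (hcard : ∀ s α, (J s α).card = (s : ℕ) + 1) :
    CSubequiv (fun _ : Fin N → TwoSphere =>
        (1 : Matrix (Fin (Fintype.card (C0 j t n ns))) (Fin (Fintype.card (C0 j t n ns))) ℂ))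
      (fun x => nf N j t n ns J x) := by
  have e := (Fintype.equivFin (C0 j t n ns)).symm
  exact csub_of_indep _ (fun x i => colW N j t n ns J x (e i))
    (fun i k => colW_continuous N j t n ns J (e i) k)
    (fun x => (colW_indep N j t n ns J hcard x).comp e e.injective)
    _ (fun x => nf_herm N j t n ns J x) (fun x i => colW_inv N j t n ns J x (e i))

theorem max_trivial_in_multiple (N j t n : ℕ) (ns : Fin j → ℕ)
    (J : (s : Fin j) → Fin (ns s) → Finset (Fin N))
    (hcard : ∀ s α, (J s α).card = (s : ℕ) + 1)
    (hdisj : ∀ s α s' α', (⟨s, α⟩ : Σ s : Fin j, Fin (ns s)) ≠ ⟨s', α'⟩ →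
      Disjoint (J s α) (J s' α')) :
    IsGreatest
      {c : ℕ | CSubequiv
        (fun _ : Fin N → TwoSphere => (1 : Matrix (Fin c) (Fin c) ℂ))
        (fun x => Matrix.blockDiagonal fun _ : Fin n => fProj N j t ns J x)}
      ((∑ s : Fin j, ns s * (n - ((s : ℕ) + 1))) + n * t) := by
  rw [← C0_card]
  constructor
  · exact lower N j t n ns J hcard
  · rintro c ⟨v, hv, h⟩
    exact upper N j t n ns J hcard hdisj c v hv (fun x => (h x).1) (fun x => (h x).2)
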